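/- Let f : (M,h) → (N,g) be a pluri-harmonic map from a Hermitian manifold (M,h) to a Riemannian manifold (N,g), and set u = |∂f|². Then ∂∂̄u = ⟨∂_F ∂f, ∂_F ∂f⟩ + ( R^M_{αβ̄γδ̄} h^{γν̄} h^{μδ̄} g_{ij} f^i_μ f^j_{ν̄} − R^N_{iℓkj} f^i_α f^j_{β̄} (h^{γδ̄} f^k_γ f^ℓ_{δ̄}) ) dz^α ∧ dz̄^β, where R^M_{αβ̄γδ̄} is the Chern curvature of (T^{1,0}M, h), R^N is the Riemannian curvature of (N,g), f^i_α = ∂f^i/∂z^α, f^j_{β̄} = ∂f^j/∂z̄^β, and ∂_F is the (1,0)-part of the connection on F = T^{*1,0}M ⊗ f*(TN) induced by the Chern connection on M and the Levi-Civita connection on N. -/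

import Mathlib

/- Common local-coordinate framework for harmonic maps from Hermitian manifolds
to Riemannian manifolds, following Wang-Yang, "RC-positivity and rigidity of
harmonic maps into Riemannian manifolds".

A Riemannian manifold `(N, g)` is encoded as a smooth manifold `N` modelled on
`EuclideanSpace ℝ (Fin n)` together with a `RiemannData`, i.e. the matrix of the
metric in each preferred chart `chartAt _ p`, required to be smooth, symmetric,
positive definite and compatible with the change of charts.  Christoffel symbols
and the Riemann curvature tensor are *defined* from the metric by the usual
coordinate formulas.  Similarly a Hermitian manifold `(M, h)` is encoded as a
complex manifold modelled on `EuclideanSpace ℂ (Fin m)` together with an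
`HermitianData`; the Chern connection and Chern curvature are defined from `h`
by the usual formulas, using Wirtinger derivatives.  All differential-geometric
conditions (harmonic, Hermitian harmonic, pluri-harmonic, Kähler,
astheno-Kähler, RC-positivity, complex sectional curvature ...) are then
expressed by their coordinate formulas, evaluated in the chart `chartAt _ p`
at the point `basePt p = chartAt _ p p` (every point of the manifold is of this
form). -/

open scoped Manifold ComplexOrder
open Complex Finset

noncomputable section

/-- Partial derivative ∂/∂y^i of a real-valued function on ℝ^n. -/
def rDeriv {n : ℕ} (i : Fin n) (F : EuclideanSpace ℝ (Fin n) → ℝ)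
    (y : EuclideanSpace ℝ (Fin n)) : ℝ :=
  fderiv ℝ F y (EuclideanSpace.single i 1)

/-- Wirtinger derivative ∂/∂z^α of a complex-valued function on ℂ^m. -/
def wDeriv {m : ℕ} (α : Fin m) (F : EuclideanSpace ℂ (Fin m) → ℂ)
    (z : EuclideanSpace ℂ (Fin m)) : ℂ :=
  (1 / 2) * (fderiv ℝ F z (EuclideanSpace.single α 1)
    - Complex.I * fderiv ℝ F z (EuclideanSpace.single α Complex.I))

/-- Conjugate Wirtinger derivative ∂/∂z̄^α of a complex-valued function on ℂ^m. -/
def wDerivBar {m : ℕ} (α : Fin m) (F : EuclideanSpace ℂ (Fin m) → ℂ)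
    (z : EuclideanSpace ℂ (Fin m)) : ℂ :=
  (1 / 2) * (fderiv ℝ F z (EuclideanSpace.single α 1)
    + Complex.I * fderiv ℝ F z (EuclideanSpace.single α Complex.I))

/-- Christoffel symbols Γ^i_{jk} of the Levi-Civita connection of a Riemannian
metric, given by the matrix of its coefficients in a local coordinate system:
Γ^i_{jk} = ½ g^{il}(∂_j g_{kl} + ∂_k g_{jl} - ∂_l g_{jk}). -/
def christoffel {n : ℕ} (g : EuclideanSpace ℝ (Fin n) → Matrix (Fin n) (Fin n) ℝ)
    (i j k : Fin n) (y : EuclideanSpace ℝ (Fin n)) : ℝ :=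
  (1 / 2) * ∑ l, (g y)⁻¹ i l *
    (rDeriv j (fun y' => g y' k l) y + rDeriv k (fun y' => g y' j l) y
      - rDeriv l (fun y' => g y' j k) y)

/-- Riemann curvature R_{ijk}^ℓ of the Levi-Civita connection:
R_{ijk}^ℓ = ∂_i Γ^ℓ_{kj} - ∂_j Γ^ℓ_{ki} + Γ^p_{kj} Γ^ℓ_{pi} - Γ^p_{ki} Γ^ℓ_{pj}. -/
def riemannUp {n : ℕ} (g : EuclideanSpace ℝ (Fin n) → Matrix (Fin n) (Fin n) ℝ)
    (i j k l : Fin n) (y : EuclideanSpace ℝ (Fin n)) : ℝ :=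
  rDeriv i (fun y' => christoffel g l k j y') y
    - rDeriv j (fun y' => christoffel g l k i y') y
    + ∑ p, christoffel g p k j y * christoffel g l p i y
    - ∑ p, christoffel g p k i y * christoffel g l p j y

/-- Riemann curvature tensor R_{ijkℓ} = g_{sℓ} R_{ijk}^s,
convention R(X,Y,Z,W) = g(R(X,Y)Z,W). -/
def riemannLo {n : ℕ} (g : EuclideanSpace ℝ (Fin n) → Matrix (Fin n) (Fin n) ℝ)
    (i j k l : Fin n) (y : EuclideanSpace ℝ (Fin n)) : ℝ :=
  ∑ s, g y s l * riemannUp g i j k s y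

/-- The data of a Riemannian metric on a manifold `N` modelled on ℝ^n: for every
`p : N`, the matrix `g p` of the metric in the coordinates of the chart
`chartAt _ p`, smooth, symmetric, positive definite, and transforming correctly
under change of charts. -/
structure RiemannData (n : ℕ) (N : Type*) [TopologicalSpace N]
    [ChartedSpace (EuclideanSpace ℝ (Fin n)) N] where
  g : N → EuclideanSpace ℝ (Fin n) → Matrix (Fin n) (Fin n) ℝ
  smooth : ∀ (p : N) (i j : Fin n), ContDiffOn ℝ (⊤ : ℕ∞) (fun y => g p y i j)
    (chartAt (EuclideanSpace ℝ (Fin n)) p).target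
  symm : ∀ p y i j, g p y i j = g p y j i
  posdef : ∀ (p : N) (y : EuclideanSpace ℝ (Fin n)),
    y ∈ (chartAt (EuclideanSpace ℝ (Fin n)) p).target →
    ∀ v : Fin n → ℝ, v ≠ 0 → 0 < ∑ i, ∑ j, g p y i j * v i * v j
  compat : ∀ p q : N,
    ∀ y ∈ ((chartAt (EuclideanSpace ℝ (Fin n)) p).symm.trans
            (chartAt (EuclideanSpace ℝ (Fin n)) q)).source, ∀ i j,
      g p y i j = ∑ k, ∑ l,
        (fderiv ℝ (((chartAt (EuclideanSpace ℝ (Fin n)) p).symm.trans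
            (chartAt (EuclideanSpace ℝ (Fin n)) q)) :
            EuclideanSpace ℝ (Fin n) → EuclideanSpace ℝ (Fin n)) y
            (EuclideanSpace.single i 1) k) *
        (fderiv ℝ (((chartAt (EuclideanSpace ℝ (Fin n)) p).symm.trans
            (chartAt (EuclideanSpace ℝ (Fin n)) q)) :
            EuclideanSpace ℝ (Fin n) → EuclideanSpace ℝ (Fin n)) y
            (EuclideanSpace.single j 1) l) *
        g q (((chartAt (EuclideanSpace ℝ (Fin n)) p).symm.trans
            (chartAt (EuclideanSpace ℝ (Fin n)) q)) y) k l

/-- The base point of the preferred chart around `p`. -/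
def basePt {m : ℕ} {M : Type*} [TopologicalSpace M]
    [ChartedSpace (EuclideanSpace ℂ (Fin m)) M] (p : M) : EuclideanSpace ℂ (Fin m) :=
  chartAt (EuclideanSpace ℂ (Fin m)) p p

/-- The base point of the preferred chart around `q` in a Riemannian manifold. -/
def basePtR {n : ℕ} {N : Type*} [TopologicalSpace N]
    [ChartedSpace (EuclideanSpace ℝ (Fin n)) N] (q : N) : EuclideanSpace ℝ (Fin n) :=
  chartAt (EuclideanSpace ℝ (Fin n)) q q

/-- `(N,g)` has non-positive complex sectional curvature: the complex-linear
extension of the Riemann curvature tensor to the complexified tangent bundle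
satisfies R(Z, W̄, W, Z̄) ≤ 0 for all complex tangent vectors Z, W (the
inequality is in the partial order of `ℂ`; in particular the quantity is real). -/
def RiemannData.NonposComplexSectional {n : ℕ} {N : Type*} [TopologicalSpace N]
    [ChartedSpace (EuclideanSpace ℝ (Fin n)) N] (gD : RiemannData n N) : Prop :=
  ∀ (q : N) (Z W : Fin n → ℂ),
    (∑ i, ∑ j, ∑ k, ∑ l, (riemannLo (gD.g q) i j k l (basePtR q) : ℂ) *
      Z i * (starRingEnd ℂ) (W j) * W k * (starRingEnd ℂ) (Z l)) ≤ 0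

/-- The data of a Hermitian metric on a complex manifold `M` modelled on ℂ^m:
for every `p : M`, the matrix `h p` (with `h p z α β = h_{α β̄}(z)`) of the
metric in the chart `chartAt _ p`, smooth, Hermitian, positive definite, and
transforming correctly under the (holomorphic) change of charts. -/
structure HermitianData (m : ℕ) (M : Type*) [TopologicalSpace M]
    [ChartedSpace (EuclideanSpace ℂ (Fin m)) M] where
  h : M → EuclideanSpace ℂ (Fin m) → Matrix (Fin m) (Fin m) ℂ
  smooth : ∀ (p : M) (α β : Fin m), ContDiffOn ℝ (⊤ : ℕ∞) (fun z => h p z α β)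
    (chartAt (EuclideanSpace ℂ (Fin m)) p).target
  hermitian : ∀ p z α β, h p z α β = (starRingEnd ℂ) (h p z β α)
  posdef : ∀ (p : M) (z : EuclideanSpace ℂ (Fin m)),
    z ∈ (chartAt (EuclideanSpace ℂ (Fin m)) p).target →
    ∀ v : Fin m → ℂ, v ≠ 0 → 0 < ∑ α, ∑ β, h p z α β * v α * (starRingEnd ℂ) (v β)
  compat : ∀ p q : M,
    ∀ z ∈ ((chartAt (EuclideanSpace ℂ (Fin m)) p).symm.trans
            (chartAt (EuclideanSpace ℂ (Fin m)) q)).source, ∀ α β,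
      h p z α β = ∑ γ, ∑ δ,
        (fderiv ℂ (((chartAt (EuclideanSpace ℂ (Fin m)) p).symm.trans
            (chartAt (EuclideanSpace ℂ (Fin m)) q)) :
            EuclideanSpace ℂ (Fin m) → EuclideanSpace ℂ (Fin m)) z
            (EuclideanSpace.single α 1) γ) *
        (starRingEnd ℂ) (fderiv ℂ (((chartAt (EuclideanSpace ℂ (Fin m)) p).symm.trans
            (chartAt (EuclideanSpace ℂ (Fin m)) q)) :
            EuclideanSpace ℂ (Fin m) → EuclideanSpace ℂ (Fin m)) z
            (EuclideanSpace.single β 1) δ) *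
        h q (((chartAt (EuclideanSpace ℂ (Fin m)) p).symm.trans
            (chartAt (EuclideanSpace ℂ (Fin m)) q)) z) γ δ

namespace HermitianData

variable {m : ℕ} {M : Type*} [TopologicalSpace M]
  [ChartedSpace (EuclideanSpace ℂ (Fin m)) M]

/-- The inverse metric: `hD.up p z α β = h^{α β̄}(z)`, so that
`∑ δ, h^{γ δ̄} h_{α δ̄} = δ_{γ α}`. -/
def up (hD : HermitianData m M) (p : M) (z : EuclideanSpace ℂ (Fin m))
    (α β : Fin m) : ℂ :=
  (hD.h p z)⁻¹ β α

/-- Christoffel symbols Γ^μ_{αγ} = h^{μ δ̄} ∂_α h_{γ δ̄} of the Chern connection. -/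
def chernChristoffel (hD : HermitianData m M) (p : M) (α γ μ : Fin m)
    (z : EuclideanSpace ℂ (Fin m)) : ℂ :=
  ∑ δ, hD.up p z μ δ * wDeriv α (fun z' => hD.h p z' γ δ) z

/-- The Chern curvature tensor
R_{α β̄ γ δ̄} = -∂_α ∂̄_β h_{γ δ̄} + h^{μ ν̄} (∂_α h_{γ ν̄}) (∂̄_β h_{μ δ̄}). -/
def chern (hD : HermitianData m M) (p : M) (α β γ δ : Fin m)
    (z : EuclideanSpace ℂ (Fin m)) : ℂ :=
  - wDeriv α (fun z' => wDerivBar β (fun z'' => hD.h p z'' γ δ) z') z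
    + ∑ μ, ∑ ν, hD.up p z μ ν * wDeriv α (fun z' => hD.h p z' γ ν) z *
        wDerivBar β (fun z' => hD.h p z' μ δ) z

/-- The mixed Christoffel symbols Γ^{γ̄}_{α β̄} = conj (Γ^γ_{β ᾱ}) of the Hermitian
metric `h`, where Γ^γ_{α β̄} = ½ h^{γ δ̄} (∂ h_{α δ̄}/∂z̄^β − ∂ h_{α β̄}/∂z̄^δ). -/
def hermChristoffelBar (hD : HermitianData m M) (p : M) (α β γ : Fin m)
    (z : EuclideanSpace ℂ (Fin m)) : ℂ :=
  (starRingEnd ℂ) ((1 / 2) * ∑ δ, hD.up p z γ δ *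
    (wDerivBar α (fun z' => hD.h p z' β δ) z - wDerivBar δ (fun z' => hD.h p z' β α) z))

/-- `(T^{1,0}M, h)` is uniformly RC-positive: at every point there is a
direction `u` such that `R(u, ū, v, v̄) > 0` for every nonzero `v`. -/
def UniformlyRCPositive (hD : HermitianData m M) : Prop :=
  ∀ p : M, ∃ u : Fin m → ℂ, ∀ v : Fin m → ℂ, v ≠ 0 →
    0 < ∑ α, ∑ β, ∑ γ, ∑ δ, hD.chern p α β γ δ (basePt p) *
      u α * (starRingEnd ℂ) (u β) * v γ * (starRingEnd ℂ) (v δ)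

/-- `(M, h)` has positive holomorphic sectional curvature:
`R(v, v̄, v, v̄) > 0` for every nonzero `v`. -/
def PosHolomorphicSectional (hD : HermitianData m M) : Prop :=
  ∀ p : M, ∀ v : Fin m → ℂ, v ≠ 0 →
    0 < ∑ α, ∑ β, ∑ γ, ∑ δ, hD.chern p α β γ δ (basePt p) *
      v α * (starRingEnd ℂ) (v β) * v γ * (starRingEnd ℂ) (v δ)

/-- The second Chern-Ricci curvature `h^{α β̄} R_{α β̄ γ δ̄}` is positive definite. -/
def SecondChernRicciPositive (hD : HermitianData m M) : Prop :=
  ∀ p : M, ∀ v : Fin m → ℂ, v ≠ 0 →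
    0 < ∑ α, ∑ β, ∑ γ, ∑ δ, hD.up p (basePt p) α β *
      hD.chern p α β γ δ (basePt p) * v γ * (starRingEnd ℂ) (v δ)

/-- `(M,h)` is Kähler: ∂_α h_{β γ̄} = ∂_β h_{α γ̄} in all charts. -/
def IsKaehler (hD : HermitianData m M) : Prop :=
  ∀ (p : M) (z : EuclideanSpace ℂ (Fin m)),
    z ∈ (chartAt (EuclideanSpace ℂ (Fin m)) p).target → ∀ α β γ,
      wDeriv α (fun z' => hD.h p z' β γ) z = wDeriv β (fun z' => hD.h p z' α γ) z

/-- `(M,h)` is astheno-Kähler: `∂ ∂̄ (ω_h^{m-2}) = 0`.  The coefficients of the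
`(m-1, m-1)`-form `∂ ∂̄ (ω_h^{m-2})` are, up to a nonzero universal constant, the
antisymmetrizations (over both the holomorphic multi-index `a` and the
anti-holomorphic multi-index `b`) of
`∂_{a j₀} ∂̄_{b j₀} ∏_{j ≠ j₀} h_{a j, (b j)‾}`. -/
def IsAstheno (hD : HermitianData m M) : Prop :=
  ∀ (p : M) (a b : Fin (m - 1) → Fin m) (j₀ : Fin (m - 1)),
    ∑ σ : Equiv.Perm (Fin (m - 1)), ∑ τ : Equiv.Perm (Fin (m - 1)),
      (((Equiv.Perm.sign σ : ℤ) * (Equiv.Perm.sign τ : ℤ) : ℤ) : ℂ) *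
        wDeriv (a (σ j₀)) (fun z => wDerivBar (b (τ j₀)) (fun z' =>
          ∏ j ∈ Finset.univ.erase j₀, hD.h p z' (a (σ j)) (b (τ j))) z) (basePt p) = 0

end HermitianData

section Maps

variable {m n : ℕ} {M N : Type*} [TopologicalSpace M]
  [ChartedSpace (EuclideanSpace ℂ (Fin m)) M]
  [TopologicalSpace N] [ChartedSpace (EuclideanSpace ℝ (Fin n)) N]

/-- The coordinate representative of `f : M → N` in the preferred charts around
`p` and `f p`. -/
def chartRep (f : M → N) (p : M) :
    EuclideanSpace ℂ (Fin m) → EuclideanSpace ℝ (Fin n) :=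
  (chartAt (EuclideanSpace ℝ (Fin n)) (f p)) ∘ f ∘
    (chartAt (EuclideanSpace ℂ (Fin m)) p).symm

/-- The (complexified) components `f^i` of `f` in the preferred charts around `p`. -/
def mapComp (f : M → N) (p : M) (i : Fin n) (z : EuclideanSpace ℂ (Fin m)) : ℂ :=
  ((chartRep f p z i : ℝ) : ℂ)

/-- `f : M → N` is a smooth map (`M` being regarded as a smooth real manifold). -/
def IsSmoothMap (f : M → N) : Prop :=
  ContMDiff 𝓘(ℝ, EuclideanSpace ℂ (Fin m)) 𝓘(ℝ, EuclideanSpace ℝ (Fin n)) (⊤ : ℕ∞) f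

/-- The components `(∂_E ∂̄ f)^i_{α β̄} = ∂²f^i/∂z^α ∂z̄^β + Γ^i_{jk} f^j_{β̄} f^k_α`
of the `E = f*(TN)`-valued `(1,1)`-form `∂_E ∂̄ f`, in the charts around `p`. -/
def pluriTensor (gD : RiemannData n N) (f : M → N) (p : M) (i : Fin n)
    (α β : Fin m) (z : EuclideanSpace ℂ (Fin m)) : ℂ :=
  wDeriv α (fun z' => wDerivBar β (mapComp f p i) z') z
    + ∑ j, ∑ k, (christoffel (gD.g (f p)) i j k (chartRep f p z) : ℂ) *
        wDerivBar β (mapComp f p j) z * wDeriv α (mapComp f p k) z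

/-- `f` is pluri-harmonic: `∂_E ∂̄ f = 0`. -/
def IsPluriHarmonic (gD : RiemannData n N) (f : M → N) : Prop :=
  ∀ (p : M) (i : Fin n) (α β : Fin m), pluriTensor gD f p i α β (basePt p) = 0

/-- `f` is Hermitian harmonic:
`h^{α β̄} (∂²f^i/∂z^α ∂z̄^β + Γ^i_{jk} f^j_{β̄} f^k_α) = 0`. -/
def IsHermitianHarmonic (hD : HermitianData m M) (gD : RiemannData n N)
    (f : M → N) : Prop :=
  ∀ (p : M) (i : Fin n),
    ∑ α, ∑ β, hD.up p (basePt p) α β * pluriTensor gD f p i α β (basePt p) = 0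

/-- `f` is harmonic (critical point of the energy; Euler-Lagrange equation in
complex coordinates):
`h^{α β̄} (∂²f^i/∂z^α ∂z̄^β − 2 Γ^{γ̄}_{α β̄} ∂f^i/∂z̄^γ + Γ^i_{jk} f^j_{β̄} f^k_α) = 0`. -/
def IsHarmonicMap (hD : HermitianData m M) (gD : RiemannData n N)
    (f : M → N) : Prop :=
  ∀ (p : M) (i : Fin n),
    ∑ α, ∑ β, hD.up p (basePt p) α β * (pluriTensor gD f p i α β (basePt p)
      - 2 * ∑ γ, hD.hermChristoffelBar p α β γ (basePt p) *
          wDerivBar γ (mapComp f p i) (basePt p)) = 0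

end Maps


variable {m n : ℕ} {M N : Type*} [TopologicalSpace M]
  [ChartedSpace (EuclideanSpace ℂ (Fin m)) M]
  [TopologicalSpace N] [ChartedSpace (EuclideanSpace ℝ (Fin n)) N]

/-- The function `u = |∂f|² = h^{α β̄} g_{ij} f^i_α (f^j_β)‾`, written in the
chart around `p`. -/
def delfNormSq (hD : HermitianData m M) (gD : RiemannData n N) (f : M → N)
    (p : M) (z : EuclideanSpace ℂ (Fin m)) : ℂ :=
  ∑ α, ∑ β, ∑ i, ∑ j, hD.up p z α β * (gD.g (f p) (chartRep f p z) i j : ℂ) *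
    wDeriv α (mapComp f p i) z * (starRingEnd ℂ) (wDeriv β (mapComp f p j) z)

/-- The components `(∂_F ∂f)^i_{γ α} = ∂_α f^i_γ − Γ^μ_{α γ} f^i_μ + Γ^i_{jk} f^j_α f^k_γ`
of the `(1,0)`-derivative of `∂f` in the bundle `F = T^{*1,0}M ⊗ f^*(TN)`, with
respect to the connection induced by the Chern connection of `h` on `M` and the
Levi-Civita connection of `g` on `N`. -/
def delFdelf (hD : HermitianData m M) (gD : RiemannData n N) (f : M → N)
    (p : M) (i : Fin n) (γ α : Fin m) (z : EuclideanSpace ℂ (Fin m)) : ℂ :=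
  wDeriv α (fun z' => wDeriv γ (mapComp f p i) z') z
    - ∑ μ, hD.chernChristoffel p α γ μ z * wDeriv μ (mapComp f p i) z
    + ∑ j, ∑ k, (christoffel (gD.g (f p)) i j k (chartRep f p z) : ℂ) *
        wDeriv α (mapComp f p j) z * wDeriv γ (mapComp f p k) z

section IsometryTaylor
open Filter Topology Asymptotics

/-- Symmetric second differences converge to the second derivative. -/
lemma tendsto_symm_second_difference {E : Type*} [NormedAddCommGroup E] [NormedSpace ℝ E]
    {k k' : ℝ → E} {k'' : E} (hk : ∀ᶠ t in 𝓝 (0 : ℝ), HasDerivAt k (k' t) t)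
    (hk' : HasDerivAt k' k'' 0) :
    Tendsto (fun t : ℝ => (t ^ 2)⁻¹ • (k t + k (-t) - (2 : ℝ) • k 0)) (𝓝[≠] 0) (𝓝 k'') := by
  rw [Metric.tendsto_nhds]
  intro ε hε
  have h1 : ∀ᶠ t in 𝓝 (0 : ℝ), ‖k' t - k' 0 - (t - 0) • k''‖ ≤ ε / 4 * ‖t - 0‖ :=
    (hasDerivAt_iff_isLittleO.1 hk').def (by positivity)
  obtain ⟨δ, hδ, hball⟩ := Metric.eventually_nhds_iff.1 (h1.and hk)
  rw [eventually_nhdsWithin_iff]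
  refine Metric.eventually_nhds_iff.2 ⟨δ, hδ, fun t ht ht0 => ?_⟩
  have ht0' : t ≠ 0 := ht0
  have habs : |t| < δ := by simpa [Real.dist_eq] using ht
  have hmem : ∀ s : ℝ, |s| ≤ |t| → dist s 0 < δ := fun s hs => by
    simpa [Real.dist_eq] using hs.trans_lt habs
  have hder : ∀ s ∈ Metric.closedBall (0 : ℝ) |t|,
      HasDerivWithinAt (fun s => k s + k (-s) - (s ^ 2) • k'')
        (k' s - k' (-s) - (2 * s) • k'') (Metric.closedBall (0 : ℝ) |t|) s := by
    intro s hs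
    have hs' : |s| ≤ |t| := by simpa [Real.dist_eq] using hs
    have a1 := (hball (hmem s hs')).2
    have a2 := (hball (hmem (-s) (by simpa using hs'))).2
    have a3 : HasDerivAt (fun s : ℝ => k (-s)) (-k' (-s)) s := by
      simpa [Function.comp_def] using a2.scomp s (hasDerivAt_neg s)
    have a4 : HasDerivAt (fun s : ℝ => (s ^ 2) • k'') ((2 * s) • k'') s := by
      simpa using ((hasDerivAt_pow 2 s).smul_const k'')
    have := (a1.add a3).sub a4
    rw [← sub_eq_add_neg] at this
    exact this.hasDerivWithinAt
  have hbound : ∀ s ∈ Metric.closedBall (0 : ℝ) |t|,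
      ‖k' s - k' (-s) - (2 * s) • k''‖ ≤ ε / 2 * |t| := by
    intro s hs
    have hs' : |s| ≤ |t| := by simpa [Real.dist_eq] using hs
    have b1 := (hball (hmem s hs')).1
    have b2 := (hball (hmem (-s) (by simpa using hs'))).1
    simp only [sub_zero, Real.norm_eq_abs, abs_neg] at b1 b2
    have : k' s - k' (-s) - (2 * s) • k''
        = (k' s - k' 0 - s • k'') - (k' (-s) - k' 0 - (-s) • k'') := by
      module
    rw [this]
    refine (norm_sub_le _ _).trans ?_
    nlinarith
  have hmv := Convex.norm_image_sub_le_of_norm_hasDerivWithin_le hder hbound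
    (convex_closedBall _ _) (x := 0) (y := t) (by simp) (by simp)
  have e1 : (t ^ 2)⁻¹ • (k t + k (-t) - (2 : ℝ) • k 0) - k''
      = (t ^ 2)⁻¹ • ((k t + k (-t) - (t ^ 2) • k'') - (k 0 + k (-0) - ((0:ℝ) ^ 2) • k'')) := by
    have : (t ^ 2)⁻¹ • ((t ^ 2) • k'') = k'' := by
      rw [smul_smul, inv_mul_cancel₀ (pow_ne_zero 2 ht0'), one_smul]
    conv_lhs => rw [← this]
    simp only [neg_zero]
    module
  rw [dist_eq_norm, e1, norm_smul]
  have hpos : 0 < t ^ 2 := by positivity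
  have : ‖(t ^ 2)⁻¹‖ = (t ^ 2)⁻¹ := by
    rw [Real.norm_of_nonneg (by positivity)]
  rw [this, inv_mul_lt_iff₀ hpos]
  refine hmv.trans_lt ?_
  rw [sub_zero, Real.norm_eq_abs, mul_assoc, ← sq, sq_abs]
  nlinarith

/-- A map whose derivative has norm `1 + o(‖w‖)` near `0` stretches distances in small balls of
radius `r` by a factor of at most `1 + o(r)`. -/
lemma norm_sub_le_of_norm_fderiv_le {E F : Type*} [NormedAddCommGroup E] [NormedSpace ℝ E]
    [NormedAddCommGroup F] [NormedSpace ℝ F] {Φ : E → F}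
    (h : ∀ ε > 0, ∀ᶠ w in 𝓝 (0 : E), DifferentiableAt ℝ Φ w ∧ ‖fderiv ℝ Φ w‖ ≤ 1 + ε * ‖w‖)
    {ε : ℝ} (hε : 0 < ε) :
    ∃ δ > 0, ∀ r < δ, ∀ w₁ w₂ : E, ‖w₁‖ ≤ r → ‖w₂‖ ≤ r →
      ‖Φ w₁ - Φ w₂‖ ≤ (1 + ε * r) * ‖w₁ - w₂‖ := by
  obtain ⟨δ, hδ, hb⟩ := Metric.eventually_nhds_iff.1 (h ε hε)
  refine ⟨δ, hδ, fun r hr w₁ w₂ h₁ h₂ => ?_⟩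
  refine Convex.norm_image_sub_le_of_norm_fderiv_le (𝕜 := ℝ) (s := Metric.closedBall (0 : E) r)
    (fun w hw => (hb ?_).1) (fun w hw => ?_) (convex_closedBall _ _) (by simpa using h₂)
    (by simpa using h₁)
  · exact (Metric.mem_closedBall.1 hw).trans_lt hr
  · have hw' : ‖w‖ ≤ r := by simpa using hw
    refine (hb ((Metric.mem_closedBall.1 hw).trans_lt hr)).2.trans ?_
    gcongr

/-- `N` is a system of coordinates around `y₀` in which the quadratic form field `q` is the
standard one up to `o(‖y - y₀‖)`. -/
structure IsNormalCoord {E : Type*} [NormedAddCommGroup E] [InnerProductSpace ℝ E]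
    (q : E → E → ℝ) (N : E → E) (y₀ : E) : Prop where
  contDiff : ContDiff ℝ 2 N
  map_base : N y₀ = 0
  exists_equiv : ∃ A : E ≃L[ℝ] E, HasFDerivAt N (A : E →L[ℝ] E) y₀
  approx : ∀ ε > 0, ∀ᶠ y in 𝓝 y₀, ∀ v,
    |‖fderiv ℝ N y v‖ ^ 2 - q y v| ≤ ε * ‖y - y₀‖ * q y v

variable {E : Type*} [NormedAddCommGroup E] [InnerProductSpace ℝ E]

lemma IsNormalCoord.exists_inverse [CompleteSpace E] {q : E → E → ℝ} {N : E → E} {y₀ : E}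
    (hN : IsNormalCoord q N y₀) :
    ∃ M : E → E, ContDiffAt ℝ 1 M 0 ∧ M 0 = y₀ ∧ (∀ᶠ y in 𝓝 y₀, M (N y) = y) ∧
      ∀ᶠ w in 𝓝 (0 : E), N (M w) = w := by
  obtain ⟨A, hA⟩ := hN.exists_equiv
  have hc : ContDiffAt ℝ 1 N y₀ := (hN.contDiff.of_le (by norm_num)).contDiffAt
  have hs : HasStrictFDerivAt N (A : E →L[ℝ] E) y₀ := hc.hasStrictFDerivAt' hA (by norm_num)
  refine ⟨hs.localInverse N A y₀, ?_, ?_, hs.eventually_left_inverse, ?_⟩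
  · have := hc.to_localInverse hA (by norm_num)
    rw [hN.map_base] at this
    exact this
  · have := hs.localInverse_apply_image
    rwa [hN.map_base] at this
  · have := hs.eventually_right_inverse
    rwa [hN.map_base] at this

lemma IsNormalCoord.norm_sub_sq_le [CompleteSpace E] {q₁ q₂ : E → E → ℝ} {N₁ N₂ φ : E → E}
    {y₀ : E} (h₁ : IsNormalCoord q₁ N₁ y₀) (h₂ : IsNormalCoord q₂ N₂ (φ y₀))
    (hφ : ∀ᶠ y in 𝓝 y₀, DifferentiableAt ℝ φ y ∧ ∀ v, q₂ (φ y) (fderiv ℝ φ y v) = q₁ y v)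
    {a b : ℝ → E} (ha : (fun t => a t - y₀) =O[𝓝 0] fun t => t)
    (hb : (fun t => b t - y₀) =O[𝓝 0] fun t => t) {ε : ℝ} (hε : 0 < ε) :
    ∀ᶠ t in 𝓝 (0 : ℝ), ‖N₂ (φ (a t)) - N₂ (φ (b t))‖ ^ 2
      ≤ ‖N₁ (a t) - N₁ (b t)‖ ^ 2 + ε * |t| ^ 3 := by
  obtain ⟨M, hMc, hM0, hMN, hNM⟩ := h₁.exists_inverse
  have hMd : ∀ᶠ w in 𝓝 (0 : E), DifferentiableAt ℝ M w := by
    filter_upwards [hMc.eventually (by simp)] with w hw using hw.differentiableAt (by norm_num)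
  have hMt : Tendsto M (𝓝 0) (𝓝 y₀) := by
    have := hMc.continuousAt.tendsto
    rwa [hM0] at this
  have hφd : DifferentiableAt ℝ φ y₀ := hφ.self_of_nhds.1
  have hφt : Tendsto φ (𝓝 y₀) (𝓝 (φ y₀)) := hφd.continuousAt.tendsto
  have hMd0 : DifferentiableAt ℝ M 0 := hMc.differentiableAt (by norm_num)
  obtain ⟨C₁, hC₁⟩ := (hMd0.hasFDerivAt.isBigO_sub).bound
  obtain ⟨C₂, hC₂⟩ := ((by rw [hM0]; exact hφd : DifferentiableAt ℝ φ (M 0)).comp 0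
    hMd0).hasFDerivAt.isBigO_sub.bound
  simp only [sub_zero, hM0, Function.comp_apply] at hC₁ hC₂
  have key : ∀ ε > 0, ∀ᶠ w in 𝓝 (0 : E), DifferentiableAt ℝ (fun w => N₂ (φ (M w))) w ∧
      ‖fderiv ℝ (fun w => N₂ (φ (M w))) w‖ ≤ 1 + ε * ‖w‖ := by
    intro ε hε
    set C := max 1 (max C₁ C₂) with hC
    have hCpos : 0 < C := lt_of_lt_of_le one_pos (le_max_left _ _)
    have hsmall : ∀ᶠ w in 𝓝 (0 : E), ε / 2 * ‖w‖ ≤ 1 / 2 := by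
      have : Tendsto (fun w : E => ε / 2 * ‖w‖) (𝓝 0) (𝓝 (ε / 2 * ‖(0 : E)‖)) :=
        (continuous_const.mul continuous_norm).tendsto 0
      exact (this.eventually (gt_mem_nhds (by simp : ε / 2 * ‖(0 : E)‖ < 1 / 2))).mono
        fun _ h => le_of_lt h
    have hε' : 0 < ε / (2 * C) := by positivity
    filter_upwards [hMd, hMt.eventually hφ, hMt.eventually (h₁.approx _ hε'),
      (hφt.comp hMt).eventually (h₂.approx _ hε'), hC₁, hC₂, hsmall, hNM.eventually_nhds]
      with w w1 w2 w3 w4 w5 w6 w7 w8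
    have hN₁ : DifferentiableAt ℝ N₁ (M w) := h₁.contDiff.differentiable (by norm_num) _
    have hN₂ : DifferentiableAt ℝ N₂ (φ (M w)) := h₂.contDiff.differentiable (by norm_num) _
    have hd := hN₂.hasFDerivAt.comp w (w2.1.hasFDerivAt.comp w w1.hasFDerivAt)
    have hid : (fderiv ℝ N₁ (M w)).comp (fderiv ℝ M w) = ContinuousLinearMap.id ℝ E := by
      have e1 := hN₁.hasFDerivAt.comp w w1.hasFDerivAt
      have e2 : HasFDerivAt (N₁ ∘ M) (ContinuousLinearMap.id ℝ E) w :=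
        (hasFDerivAt_id w).congr_of_eventuallyEq w8
      exact e1.unique e2
    refine ⟨hd.differentiableAt, ?_⟩
    refine ContinuousLinearMap.opNorm_le_bound _ (by positivity) fun v => ?_
    have hfd : fderiv ℝ (fun w => N₂ (φ (M w))) w v
        = fderiv ℝ N₂ (φ (M w)) (fderiv ℝ φ (M w) (fderiv ℝ M w v)) := by
      have : fderiv ℝ (fun w => N₂ (φ (M w))) w = _ := hd.fderiv
      rw [this]; rfl
    rw [hfd]
    have b1 := (abs_le.1 (w3 (fderiv ℝ M w v))).1
    have b1' := (abs_le.1 (w3 (fderiv ℝ M w v))).2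
    have b2 := (abs_le.1 (w4 (fderiv ℝ φ (M w) (fderiv ℝ M w v)))).2
    simp only [Function.comp_apply] at b2
    have hv : fderiv ℝ N₁ (M w) (fderiv ℝ M w v) = v := by
      simpa using congrArg (fun T : E →L[ℝ] E => T v) hid
    rw [hv] at b1 b1'
    rw [w2.2] at b2
    set Q := q₁ (M w) (fderiv ℝ M w v)
    set X := ‖fderiv ℝ N₂ (φ (M w)) (fderiv ℝ φ (M w) (fderiv ℝ M w v))‖
    have s1 : ε / (2 * C) * ‖M w - y₀‖ ≤ ε / 2 * ‖w‖ := by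
      have : ‖M w - y₀‖ ≤ C * ‖w‖ := w5.trans (by
        gcongr; exact (le_max_left _ _).trans (le_max_right _ _))
      calc _ ≤ ε / (2 * C) * (C * ‖w‖) := by gcongr
        _ = _ := by field_simp
    have s2 : ε / (2 * C) * ‖φ (M w) - φ y₀‖ ≤ ε / 2 * ‖w‖ := by
      have : ‖φ (M w) - φ y₀‖ ≤ C * ‖w‖ := w6.trans (by
        gcongr; exact (le_max_right _ _).trans (le_max_right _ _))
      calc _ ≤ ε / (2 * C) * (C * ‖w‖) := by gcongr
        _ = _ := by field_simp
    have s0 : 0 ≤ ε / (2 * C) * ‖M w - y₀‖ := by positivity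
    set x := ε / 2 * ‖w‖ with hx
    have hx0 : 0 ≤ x := by positivity
    have hQ : 0 ≤ Q := by
      by_contra hneg
      push Not at hneg
      nlinarith [sq_nonneg ‖v‖]
    have r1 : (1 - x) * Q ≤ ‖v‖ ^ 2 := by nlinarith
    have r2 : X ^ 2 ≤ (1 + x) * Q := by nlinarith
    have r3 : (1 + x) * Q ≤ (1 + 2 * x) ^ 2 * ((1 - x) * Q) := by
      have : (1 + x) ≤ (1 + 2 * x) ^ 2 * (1 - x) := by nlinarith [mul_nonneg hx0 hx0]
      nlinarith
    have r4 : X ^ 2 ≤ ((1 + ε * ‖w‖) * ‖v‖) ^ 2 := by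
      have : ε * ‖w‖ = 2 * x := by rw [hx]; ring
      rw [this, mul_pow]
      exact r2.trans (r3.trans (by gcongr))
    exact le_of_sq_le_sq r4 (by positivity)
  obtain ⟨Ca, hCa⟩ := ha.bound
  obtain ⟨Cb, hCb⟩ := hb.bound
  obtain ⟨K, hK⟩ := ((h₁.contDiff.differentiable (by norm_num) y₀).hasFDerivAt.isBigO_sub).bound
  rw [h₁.map_base] at hK
  have hat : Tendsto a (𝓝 0) (𝓝 y₀) := by
    have := ha.trans_tendsto tendsto_id
    simpa using this.add_const y₀
  have hbt : Tendsto b (𝓝 0) (𝓝 y₀) := by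
    have := hb.trans_tendsto tendsto_id
    simpa using this.add_const y₀
  set R := max 1 (|K| * max |Ca| |Cb|) with hR
  have hRpos : 0 < R := lt_of_lt_of_le one_pos (le_max_left _ _)
  obtain ⟨δ, hδ, hΦ⟩ := norm_sub_le_of_norm_fderiv_le key
    (ε := min 1 (ε / (12 * R ^ 3))) (by positivity)
  set η := min 1 (ε / (12 * R ^ 3)) with hη
  have hη0 : 0 < η := by positivity
  have hsm : ∀ᶠ t in 𝓝 (0 : ℝ), R * |t| < min δ 1 := by
    have : Tendsto (fun t : ℝ => R * |t|) (𝓝 0) (𝓝 (R * |0|)) :=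
      (continuous_const.mul continuous_abs).tendsto 0
    exact this.eventually (gt_mem_nhds (by simpa using hδ))
  filter_upwards [hat.eventually hMN, hbt.eventually hMN, hat.eventually hK, hbt.eventually hK,
    hCa, hCb, hsm] with t t1 t2 t3 t4 t5 t6 t7
  simp only [sub_zero, Real.norm_eq_abs] at t3 t4 t5 t6
  have n1 : ‖N₁ (a t)‖ ≤ R * |t| := by
    calc ‖N₁ (a t)‖ ≤ |K| * (|Ca| * |t|) := t3.trans (by
          refine mul_le_mul (le_abs_self _) (t5.trans ?_) (norm_nonneg _) (abs_nonneg _)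
          gcongr; exact le_abs_self _)
      _ ≤ |K| * (max |Ca| |Cb| * |t|) := by gcongr; exact le_max_left _ _
      _ = (|K| * max |Ca| |Cb|) * |t| := by ring
      _ ≤ _ := by gcongr; exact le_max_right _ _
  have n2 : ‖N₁ (b t)‖ ≤ R * |t| := by
    calc ‖N₁ (b t)‖ ≤ |K| * (|Cb| * |t|) := t4.trans (by
          refine mul_le_mul (le_abs_self _) (t6.trans ?_) (norm_nonneg _) (abs_nonneg _)
          gcongr; exact le_abs_self _)
      _ ≤ |K| * (max |Ca| |Cb| * |t|) := by gcongr; exact le_max_right _ _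
      _ = (|K| * max |Ca| |Cb|) * |t| := by ring
      _ ≤ _ := by gcongr; exact le_max_right _ _
  have fin := hΦ (R * |t|) (t7.trans_le (min_le_left _ _)) _ _ n1 n2
  simp only [t1, t2] at fin
  set D := ‖N₁ (a t) - N₁ (b t)‖ with hD
  set ρ := R * |t| with hρ
  have hρ0 : 0 ≤ ρ := by positivity
  have hρ1 : ρ < 1 := t7.trans_le (min_le_right _ _)
  have hD2 : D ≤ 2 * ρ := (norm_sub_le _ _).trans (by linarith)
  have hη1 : η ≤ 1 := min_le_left _ _
  have hη2 : η * (12 * R ^ 3) ≤ ε := by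
    rw [← le_div_iff₀ (by positivity)]; exact min_le_right _ _
  calc ‖N₂ (φ (a t)) - N₂ (φ (b t))‖ ^ 2 ≤ ((1 + η * ρ) * D) ^ 2 := by gcongr
    _ = D ^ 2 + (2 * (η * ρ) + (η * ρ) ^ 2) * D ^ 2 := by ring
    _ ≤ D ^ 2 + (3 * (η * ρ)) * (2 * ρ) ^ 2 := by
        have : (η * ρ) ^ 2 ≤ η * ρ := by
          have h0 : 0 ≤ η * ρ := by positivity
          have h1 : η * ρ ≤ 1 := by nlinarith
          nlinarith
        gcongr
        linarith
    _ = D ^ 2 + (η * (12 * R ^ 3)) * |t| ^ 3 := by rw [hρ]; ring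
    _ ≤ _ := by gcongr

end IsometryTaylor

section IsometryTaylor
open Filter Topology Asymptotics
variable {E : Type*} [NormedAddCommGroup E] [InnerProductSpace ℝ E]

/-- In normal coordinates, differentiable isometries preserve inner products up to third order. -/
lemma IsNormalCoord.inner_sub_inner_isLittleO [CompleteSpace E] {q₁ q₂ : E → E → ℝ}
    {N₁ N₂ : E → E} {φ : OpenPartialHomeomorph E E} {y₀ : E} (hy₀ : y₀ ∈ φ.source)
    (h₁ : IsNormalCoord q₁ N₁ y₀) (h₂ : IsNormalCoord q₂ N₂ (φ y₀))
    (hφ : ∀ y ∈ φ.source, DifferentiableAt ℝ φ y ∧ ∀ v, q₂ (φ y) (fderiv ℝ φ y v) = q₁ y v)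
    (hφ' : ∀ y ∈ φ.target, DifferentiableAt ℝ φ.symm y ∧
      ∀ v, q₁ (φ.symm y) (fderiv ℝ φ.symm y v) = q₂ y v)
    {a b : ℝ → E} (ha : (fun t => a t - y₀) =O[𝓝 0] fun t => t)
    (hb : (fun t => b t - y₀) =O[𝓝 0] fun t => t) :
    (fun t => inner ℝ (N₂ (φ (a t))) (N₂ (φ (b t))) - inner ℝ (N₁ (a t)) (N₁ (b t)))
      =o[𝓝 0] fun t : ℝ => t ^ 3 := by
  have hsrc : ∀ᶠ y in 𝓝 y₀, y ∈ φ.source := φ.open_source.mem_nhds hy₀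
  have htgt : ∀ᶠ y in 𝓝 (φ y₀), y ∈ φ.target := φ.open_target.mem_nhds (φ.map_source hy₀)
  have hφe := hsrc.mono hφ
  have hφe' := htgt.mono hφ'
  have hO : ∀ {c : ℝ → E}, (fun t => c t - y₀) =O[𝓝 0] (fun t => t) →
      (fun t => φ (c t) - φ y₀) =O[𝓝 0] (fun t => t) := by
    intro c hc
    have hct : Tendsto c (𝓝 0) (𝓝 y₀) := by
      have := hc.trans_tendsto tendsto_id
      simpa using this.add_const y₀
    exact ((hφ y₀ hy₀).1.hasFDerivAt.isBigO_sub.comp_tendsto hct).trans hc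
  have sq : ∀ {c d : ℝ → E}, (fun t => c t - y₀) =O[𝓝 0] (fun t => t) →
      (fun t => d t - y₀) =O[𝓝 0] (fun t => t) → ∀ ε > 0, ∀ᶠ t in 𝓝 (0 : ℝ),
      |‖N₂ (φ (c t)) - N₂ (φ (d t))‖ ^ 2 - ‖N₁ (c t) - N₁ (d t)‖ ^ 2| ≤ ε * |t| ^ 3 := by
    intro c d hc hd ε hε
    have u := h₁.norm_sub_sq_le h₂ hφe hc hd hε
    have h₁' : IsNormalCoord q₁ N₁ (φ.symm (φ y₀)) := by rwa [φ.left_inv hy₀]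
    have l := h₂.norm_sub_sq_le h₁' hφe' (hO hc) (hO hd) hε
    have hct : Tendsto c (𝓝 0) (𝓝 y₀) := by
      have := hc.trans_tendsto tendsto_id
      simpa using this.add_const y₀
    have hdt : Tendsto d (𝓝 0) (𝓝 y₀) := by
      have := hd.trans_tendsto tendsto_id
      simpa using this.add_const y₀
    filter_upwards [u, l, hct.eventually hsrc, hdt.eventually hsrc] with t t1 t2 t3 t4
    rw [φ.left_inv t3, φ.left_inv t4] at t2
    rw [abs_le]
    constructor <;> linarith
  have h0 : (fun _ : ℝ => y₀ - y₀) =O[𝓝 0] (fun t : ℝ => t) := by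
    simpa using isBigO_zero _ _
  refine IsLittleO.of_bound fun ε hε => ?_
  have e3 : 0 < ε / 3 := by positivity
  filter_upwards [sq ha hb _ e3, sq ha h0 _ e3, sq hb h0 _ e3] with t t1 t2 t3
  rw [h₁.map_base, h₂.map_base, sub_zero, sub_zero] at t2 t3
  rw [norm_sub_sq_real, norm_sub_sq_real] at t1
  rw [Real.norm_eq_abs, norm_pow, Real.norm_eq_abs]
  have p : 0 ≤ ε * |t| ^ 3 := by positivity
  rw [abs_le] at t1 t2 t3 ⊢
  constructor <;> linarith

/-- If two curves through the same point have opposite accelerations, in normal coordinates,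
after applying a differentiable isometry, then so they have before. -/
lemma IsNormalCoord.second_difference_eq_zero [CompleteSpace E] {q₁ q₂ : E → E → ℝ}
    {N₁ N₂ : E → E} {φ : OpenPartialHomeomorph E E} {y₀ : E} (hy₀ : y₀ ∈ φ.source)
    (h₁ : IsNormalCoord q₁ N₁ y₀) (h₂ : IsNormalCoord q₂ N₂ (φ y₀))
    (hφ : ∀ y ∈ φ.source, DifferentiableAt ℝ φ y ∧ ∀ v, q₂ (φ y) (fderiv ℝ φ y v) = q₁ y v)
    (hφ' : ∀ y ∈ φ.target, DifferentiableAt ℝ φ.symm y ∧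
      ∀ v, q₁ (φ.symm y) (fderiv ℝ φ.symm y v) = q₂ y v)
    {c d : ℝ → E} (hc0 : c 0 = y₀) (hd0 : d 0 = y₀) (hc : DifferentiableAt ℝ c 0)
    (hd : DifferentiableAt ℝ d 0) {L : E}
    (hL : Tendsto (fun t : ℝ => (t ^ 2)⁻¹ • (N₁ (c t) + N₁ (c (-t)) + (N₁ (d t) + N₁ (d (-t)))))
      (𝓝[≠] 0) (𝓝 L))
    (hL' : Tendsto (fun t : ℝ => (t ^ 2)⁻¹ • (N₂ (φ (c t)) + N₂ (φ (c (-t)))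
      + (N₂ (φ (d t)) + N₂ (φ (d (-t)))))) (𝓝[≠] 0) (𝓝 0)) : L = 0 := by
  obtain ⟨A, hA⟩ := h₁.exists_equiv
  set y : ℝ → E := fun t => y₀ + t • A.symm L with hy
  have hyd : HasDerivAt y (A.symm L) 0 := by
    simpa [hy] using ((hasDerivAt_id (0 : ℝ)).smul_const (A.symm L)).const_add y₀
  have hy0 : y 0 = y₀ := by simp [hy]
  have hO : ∀ {c : ℝ → E}, c 0 = y₀ → DifferentiableAt ℝ c 0 →
      (fun t => c t - y₀) =O[𝓝 0] (fun t => t) := by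
    intro c h0 hc
    simpa [h0] using hc.hasFDerivAt.isBigO_sub
  have hneg : ∀ {c : ℝ → E}, DifferentiableAt ℝ c 0 → DifferentiableAt ℝ (fun t => c (-t)) 0 := by
    intro c hc
    have : DifferentiableAt ℝ c (-(0 : ℝ)) := by simpa using hc
    exact this.comp (0 : ℝ) differentiable_neg.differentiableAt
  have hyO := hO hy0 hyd.differentiableAt
  have i1 := h₁.inner_sub_inner_isLittleO hy₀ h₂ hφ hφ' (hO hc0 hc) hyO
  have i2 := h₁.inner_sub_inner_isLittleO hy₀ h₂ hφ hφ' (hO (by simpa using hc0) (hneg hc)) hyO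
  have i3 := h₁.inner_sub_inner_isLittleO hy₀ h₂ hφ hφ' (hO hd0 hd) hyO
  have i4 := h₁.inner_sub_inner_isLittleO hy₀ h₂ hφ hφ' (hO (by simpa using hd0) (hneg hd)) hyO
  have lim : Tendsto (fun t : ℝ => inner ℝ ((t ^ 2)⁻¹ • (N₂ (φ (c t)) + N₂ (φ (c (-t)))
      + (N₂ (φ (d t)) + N₂ (φ (d (-t)))))) (t⁻¹ • N₂ (φ (y t))) -
      inner ℝ ((t ^ 2)⁻¹ • (N₁ (c t) + N₁ (c (-t)) + (N₁ (d t) + N₁ (d (-t)))))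
        (t⁻¹ • N₁ (y t))) (𝓝[≠] 0) (𝓝 0) := by
    have := (((i1.add i2).add (i3.add i4)).tendsto_div_nhds_zero).mono_left
      (nhdsWithin_le_nhds (s := {0}ᶜ))
    refine this.congr fun t => ?_
    simp only [inner_add_left, inner_smul_left, inner_smul_right, RCLike.conj_to_real]
    rw [show t ^ 3 = t ^ 2 * t by ring, div_eq_mul_inv, mul_inv]
    ring
  have slope0 : ∀ {k : ℝ → E} {k' : E}, k 0 = 0 → HasDerivAt k k' 0 →
      Tendsto (fun t : ℝ => t⁻¹ • k t) (𝓝[≠] 0) (𝓝 k') := by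
    intro k k' h0 h
    simpa [h0] using h.tendsto_slope_zero
  have y1 : Tendsto (fun t : ℝ => t⁻¹ • N₁ (y t)) (𝓝[≠] 0) (𝓝 L) := by
    refine slope0 (by rw [hy0, h₁.map_base]) ?_
    rw [← hy0] at hA
    simpa [Function.comp_def] using hA.comp_hasDerivAt 0 hyd
  obtain ⟨K, y2⟩ : ∃ K, Tendsto (fun t : ℝ => t⁻¹ • N₂ (φ (y t))) (𝓝[≠] 0) (𝓝 K) := by
    have d1 : DifferentiableAt ℝ φ (y 0) := by rw [hy0]; exact (hφ y₀ hy₀).1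
    have d2 : DifferentiableAt ℝ N₂ (φ (y 0)) := h₂.contDiff.differentiable (by norm_num) _
    have d3 := (d2.comp (y 0) d1).hasFDerivAt.comp_hasDerivAt 0 hyd
    exact ⟨_, slope0 (by simp only [hy0, h₂.map_base]) d3⟩
  have hsub := (Tendsto.inner (𝕜 := ℝ) hL' y2).sub (Tendsto.inner (𝕜 := ℝ) hL y1)
  have e := tendsto_nhds_unique lim hsub
  rw [inner_zero_left, zero_sub] at e
  exact inner_self_eq_zero.1 (neg_eq_zero.1 e.symm)

end IsometryTaylor

section NormalCoord
open Filter Topology Asymptotics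

section
open scoped MatrixOrder Matrix.Norms.L2Operator Matrix

lemma Matrix.PosDef.exists_transpose_mul_self {n : ℕ} {G : Matrix (Fin n) (Fin n) ℝ}
    (hG : G.PosDef) : ∃ S : Matrix (Fin n) (Fin n) ℝ, Sᵀ * S = G ∧ IsUnit S := by
  have h0 : 0 ≤ G := hG.posSemidef.nonneg
  have hs : CFC.sqrt G * CFC.sqrt G = G := CFC.sqrt_mul_sqrt_self _ h0
  have hh : (CFC.sqrt G).IsHermitian :=
    (Matrix.nonneg_iff_posSemidef.1 (CFC.sqrt_nonneg G)).isHermitian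
  refine ⟨CFC.sqrt G, ?_, ?_⟩
  · have : (CFC.sqrt G)ᵀ = CFC.sqrt G := by
      ext i j
      simpa using congrFun (congrFun hh i) j
    rw [this, hs]
  · have := hG.isUnit
    rw [← hs] at this
    exact isUnit_of_mul_isUnit_left this

end

variable {n : ℕ}

/-- The quadratic form of a matrix field. -/
def quadForm (g : EuclideanSpace ℝ (Fin n) → Matrix (Fin n) (Fin n) ℝ)
    (y v : EuclideanSpace ℝ (Fin n)) : ℝ :=
  ∑ i, ∑ j, g y i j * v i * v j

/-- The Christoffel symbols as a bilinear map. -/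
def christoffelBilin (g : EuclideanSpace ℝ (Fin n) → Matrix (Fin n) (Fin n) ℝ)
    (y : EuclideanSpace ℝ (Fin n)) :
    EuclideanSpace ℝ (Fin n) →L[ℝ] EuclideanSpace ℝ (Fin n) →L[ℝ] EuclideanSpace ℝ (Fin n) :=
  ∑ i, ∑ j, ∑ k, christoffel g i j k y • (EuclideanSpace.proj j : EuclideanSpace ℝ (Fin n) →L[ℝ] ℝ).smulRight
    ((EuclideanSpace.proj k : EuclideanSpace ℝ (Fin n) →L[ℝ] ℝ).smulRight
      (EuclideanSpace.single i (1 : ℝ)))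

lemma christoffelBilin_apply (g : EuclideanSpace ℝ (Fin n) → Matrix (Fin n) (Fin n) ℝ)
    (y u v : EuclideanSpace ℝ (Fin n)) (i : Fin n) :
    christoffelBilin g y u v i = ∑ j, ∑ k, christoffel g i j k y * u j * v k := by
  simp [christoffelBilin, Finset.sum_apply, Pi.single_apply, mul_assoc]

lemma christoffel_symm {g : EuclideanSpace ℝ (Fin n) → Matrix (Fin n) (Fin n) ℝ}
    (hs : ∀ y i j, g y i j = g y j i) (i j k : Fin n) (y : EuclideanSpace ℝ (Fin n)) :
    christoffel g i j k y = christoffel g i k j y := by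
  unfold christoffel
  congr 1
  refine Finset.sum_congr rfl fun l _ => ?_
  simp_rw [hs _ j k]
  ring

lemma christoffelBilin_symm {g : EuclideanSpace ℝ (Fin n) → Matrix (Fin n) (Fin n) ℝ}
    (hs : ∀ y i j, g y i j = g y j i) (y u v : EuclideanSpace ℝ (Fin n)) :
    christoffelBilin g y u v = christoffelBilin g y v u := by
  ext i
  rw [christoffelBilin_apply, christoffelBilin_apply, Finset.sum_comm]
  refine Finset.sum_congr rfl fun k _ => Finset.sum_congr rfl fun j _ => ?_
  rw [christoffel_symm hs i j k]
  ring

lemma sum_mul_christoffel {g : EuclideanSpace ℝ (Fin n) → Matrix (Fin n) (Fin n) ℝ}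
    {y : EuclideanSpace ℝ (Fin n)} (hu : IsUnit (g y)) (i j k : Fin n) :
    ∑ l, g y j l * christoffel g l k i y = (1 / 2) *
      (rDeriv k (fun y' => g y' i j) y + rDeriv i (fun y' => g y' k j) y
        - rDeriv j (fun y' => g y' k i) y) := by
  have hdet := (Matrix.isUnit_iff_isUnit_det _).1 hu
  have h1 : ∀ s, ∑ l, g y j l * (g y)⁻¹ l s = if j = s then 1 else 0 := by
    intro s
    rw [← Matrix.mul_apply, Matrix.mul_nonsing_inv _ hdet, Matrix.one_apply]
  unfold christoffel
  simp_rw [Finset.mul_sum]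
  rw [Finset.sum_comm]
  have : ∀ s, ∑ l, g y j l * ((1 / 2) * ((g y)⁻¹ l s *
      (rDeriv k (fun y' => g y' i s) y + rDeriv i (fun y' => g y' k s) y
        - rDeriv s (fun y' => g y' k i) y))) = (if j = s then 1 else 0) * ((1 / 2) *
      (rDeriv k (fun y' => g y' i s) y + rDeriv i (fun y' => g y' k s) y
        - rDeriv s (fun y' => g y' k i) y)) := by
    intro s
    rw [← h1 s, Finset.sum_mul]
    refine Finset.sum_congr rfl fun l _ => ?_
    ring
  simp_rw [this]
  simp

/-- The Levi-Civita connection is compatible with the metric. -/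
lemma rDeriv_metric {g : EuclideanSpace ℝ (Fin n) → Matrix (Fin n) (Fin n) ℝ}
    (hs : ∀ y i j, g y i j = g y j i)
    {y : EuclideanSpace ℝ (Fin n)} (hu : IsUnit (g y)) (i j k : Fin n) :
    rDeriv k (fun y' => g y' i j) y
      = ∑ l, (christoffel g l k i y * g y l j + christoffel g l k j y * g y i l) := by
  have e1 := sum_mul_christoffel hu i j k
  have e2 := sum_mul_christoffel hu j i k
  have : ∑ l, (christoffel g l k i y * g y l j + christoffel g l k j y * g y i l)
      = ∑ l, g y j l * christoffel g l k i y + ∑ l, g y i l * christoffel g l k j y := by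
    rw [← Finset.sum_add_distrib]
    refine Finset.sum_congr rfl fun l _ => ?_
    rw [hs y l j]; ring
  rw [this, e1, e2]
  simp_rw [hs _ j i, hs _ k i, hs _ k j]
  ring

lemma abs_sum_mul_mul_le (r : Fin n → Fin n → ℝ) (v : EuclideanSpace ℝ (Fin n)) :
    |∑ i, ∑ j, r i j * v i * v j| ≤ (∑ i, ∑ j, |r i j|) * ‖v‖ ^ 2 := by
  simp_rw [Finset.sum_mul]
  refine (Finset.abs_sum_le_sum_abs _ _).trans (Finset.sum_le_sum fun i _ => ?_)
  refine (Finset.abs_sum_le_sum_abs _ _).trans (Finset.sum_le_sum fun j _ => ?_)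
  rw [abs_mul, abs_mul, mul_assoc, sq]
  have hi : |v i| ≤ ‖v‖ := PiLp.norm_apply_le v i
  have hj : |v j| ≤ ‖v‖ := PiLp.norm_apply_le v j
  gcongr

lemma posDef_of_quadForm_pos {G : Matrix (Fin n) (Fin n) ℝ} (hs : ∀ i j, G i j = G j i)
    (hp : ∀ v : Fin n → ℝ, v ≠ 0 → 0 < ∑ i, ∑ j, G i j * v i * v j) : G.PosDef := by
  refine Matrix.PosDef.of_dotProduct_mulVec_pos ?_ fun v hv => ?_
  · ext i j
    simp [Matrix.conjTranspose_apply, hs j i]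
  · refine (hp v hv).trans_eq ?_
    simp only [dotProduct, Matrix.mulVec, Finset.mul_sum, star_trivial]
    refine Finset.sum_congr rfl fun i _ => Finset.sum_congr rfl fun j _ => by ring

lemma exists_isometry_quadForm (g : EuclideanSpace ℝ (Fin n) → Matrix (Fin n) (Fin n) ℝ)
    (y : EuclideanSpace ℝ (Fin n)) (hp : (g y).PosDef) :
    ∃ A : EuclideanSpace ℝ (Fin n) ≃L[ℝ] EuclideanSpace ℝ (Fin n),
      ∀ v, ‖A v‖ ^ 2 = quadForm g y v := by
  obtain ⟨S, hS, hu⟩ := hp.exists_transpose_mul_self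
  have hentry : ∀ i j, g y i j = ∑ k, S k i * S k j := by
    intro i j
    rw [← hS, Matrix.mul_apply]
    rfl
  obtain ⟨u, rfl⟩ := hu
  set T := Matrix.toEuclideanCLM (n := Fin n) (𝕜 := ℝ) with hT
  refine ⟨ContinuousLinearEquiv.equivOfInverse (T u.val) (T (u⁻¹).val) ?_ ?_, fun v => ?_⟩
  · intro v
    rw [← mul_apply_eq_comp, ← map_mul]
    simp
  · intro v
    rw [← mul_apply_eq_comp, ← map_mul]
    simp
  · rw [EuclideanSpace.norm_sq_eq]
    have : ∀ k, ((ContinuousLinearEquiv.equivOfInverse (T u.val) (T (u⁻¹).val) (by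
        intro v; rw [← mul_apply_eq_comp, ← map_mul]; simp) (by
        intro v; rw [← mul_apply_eq_comp, ← map_mul]; simp)) v) k
        = ∑ i, u.val k i * v i := by
      intro k
      rw [ContinuousLinearEquiv.equivOfInverse_apply]
      rfl
    simp only [this, Real.norm_eq_abs, sq_abs, quadForm, hentry]
    simp_rw [sq, Finset.sum_mul_sum, Finset.sum_mul]
    rw [Finset.sum_comm]
    refine Finset.sum_congr rfl fun i _ => ?_
    rw [Finset.sum_comm]
    refine Finset.sum_congr rfl fun j _ => Finset.sum_congr rfl fun k _ => by ring

lemma hasFDerivAt_sub_add_half_bilin {E : Type*} [NormedAddCommGroup E] [NormedSpace ℝ E]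
    {B : E →L[ℝ] E →L[ℝ] E} (hB : ∀ u v, B u v = B v u) (y₀ y : E) :
    HasFDerivAt (fun y => (y - y₀) + (1 / 2 : ℝ) • B (y - y₀) (y - y₀))
      (ContinuousLinearMap.id ℝ E + B (y - y₀)) y := by
  have h1 : HasFDerivAt (fun y : E => y - y₀) (ContinuousLinearMap.id ℝ E) y :=
    (hasFDerivAt_id y).sub_const y₀
  have h2 := (((B.hasFDerivAt (x := y - y₀)).comp y h1).clm_apply h1).const_smul (1 / 2 : ℝ)
  refine (h1.add h2).congr_fderiv ?_
  ext v
  have e : B v (y - y₀) = B (y - y₀) v := hB _ _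
  have e2 : (1 / 2 : ℝ) • (B (y - y₀) v + B (y - y₀) v) = B (y - y₀) v := by
    rw [← two_smul ℝ, smul_smul]; norm_num
  simpa only [add_apply, _root_.smul_apply, ContinuousLinearMap.comp_apply,
    ContinuousLinearMap.flip_apply, ContinuousLinearMap.id_apply, Function.comp_apply, e,
    add_right_inj] using e2

lemma quadForm_add (g : EuclideanSpace ℝ (Fin n) → Matrix (Fin n) (Fin n) ℝ)
    (hs : ∀ y i j, g y i j = g y j i) (y v b : EuclideanSpace ℝ (Fin n)) :
    quadForm g y (v + b) = quadForm g y v + 2 * (∑ i, ∑ j, g y i j * b i * v j)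
      + quadForm g y b := by
  have h : ∑ i, ∑ j, g y i j * v i * b j = ∑ i, ∑ j, g y i j * b i * v j := by
    rw [Finset.sum_comm]
    refine Finset.sum_congr rfl fun i _ => Finset.sum_congr rfl fun j _ => ?_
    rw [hs y j i]; ring
  rw [two_mul]
  nth_rewrite 1 [← h]
  simp only [quadForm, ← Finset.sum_add_distrib]
  refine Finset.sum_congr rfl fun i _ => Finset.sum_congr rfl fun j _ => ?_
  simp only [PiLp.add_apply]
  ring

lemma fderiv_apply_eq_sum_rDeriv (F : EuclideanSpace ℝ (Fin n) → ℝ)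
    (y w : EuclideanSpace ℝ (Fin n)) :
    fderiv ℝ F y w = ∑ k, w k * rDeriv k F y := by
  have hw : w = ∑ k, w k • EuclideanSpace.single k (1 : ℝ) := by
    ext i
    simp [Pi.single_apply]
  conv_lhs => rw [hw]
  simp [rDeriv]

lemma sum_fderiv_metric {g : EuclideanSpace ℝ (Fin n) → Matrix (Fin n) (Fin n) ℝ}
    (hs : ∀ y i j, g y i j = g y j i)
    {y : EuclideanSpace ℝ (Fin n)} (hu : IsUnit (g y)) (w v : EuclideanSpace ℝ (Fin n)) :
    ∑ i, ∑ j, fderiv ℝ (fun y' => g y' i j) y w * v i * v j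
      = 2 * ∑ i, ∑ j, g y i j * christoffelBilin g y w v i * v j := by
  have e1 : ∑ i, ∑ j, g y i j * christoffelBilin g y w v i * v j
      = ∑ i, ∑ j, ∑ k, ∑ l, w k * (christoffel g l k i y * g y l j) * v i * v j := by
    simp_rw [christoffelBilin_apply, Finset.mul_sum, Finset.sum_mul]
    calc ∑ l, ∑ j, ∑ k, ∑ i, g y l j * (christoffel g l k i y * w k * v i) * v j
        = ∑ l, ∑ k, ∑ j, ∑ i, g y l j * (christoffel g l k i y * w k * v i) * v j :=
          Finset.sum_congr rfl fun l _ => Finset.sum_comm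
      _ = ∑ l, ∑ k, ∑ i, ∑ j, g y l j * (christoffel g l k i y * w k * v i) * v j :=
          Finset.sum_congr rfl fun l _ => Finset.sum_congr rfl fun k _ => Finset.sum_comm
      _ = ∑ l, ∑ i, ∑ k, ∑ j, g y l j * (christoffel g l k i y * w k * v i) * v j :=
          Finset.sum_congr rfl fun l _ => Finset.sum_comm
      _ = ∑ i, ∑ l, ∑ k, ∑ j, g y l j * (christoffel g l k i y * w k * v i) * v j :=
          Finset.sum_comm
      _ = ∑ i, ∑ l, ∑ j, ∑ k, g y l j * (christoffel g l k i y * w k * v i) * v j :=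
          Finset.sum_congr rfl fun i _ => Finset.sum_congr rfl fun l _ => Finset.sum_comm
      _ = ∑ i, ∑ j, ∑ l, ∑ k, g y l j * (christoffel g l k i y * w k * v i) * v j :=
          Finset.sum_congr rfl fun i _ => Finset.sum_comm
      _ = ∑ i, ∑ j, ∑ k, ∑ l, g y l j * (christoffel g l k i y * w k * v i) * v j :=
          Finset.sum_congr rfl fun i _ => Finset.sum_congr rfl fun j _ => Finset.sum_comm
      _ = _ := by
          refine Finset.sum_congr rfl fun i _ => Finset.sum_congr rfl fun j _ =>
            Finset.sum_congr rfl fun k _ => Finset.sum_congr rfl fun l _ => by ring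
  have e2 : ∑ i, ∑ j, g y i j * christoffelBilin g y w v i * v j
      = ∑ i, ∑ j, ∑ k, ∑ l, w k * (christoffel g l k j y * g y i l) * v i * v j := by
    rw [e1, Finset.sum_comm]
    refine Finset.sum_congr rfl fun i _ => Finset.sum_congr rfl fun j _ =>
      Finset.sum_congr rfl fun k _ => Finset.sum_congr rfl fun l _ => ?_
    rw [hs y l i]; ring
  rw [two_mul]
  nth_rewrite 1 [e1]
  rw [e2]
  simp only [← Finset.sum_add_distrib]
  refine Finset.sum_congr rfl fun i _ => Finset.sum_congr rfl fun j _ => ?_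
  rw [fderiv_apply_eq_sum_rDeriv, Finset.sum_mul, Finset.sum_mul]
  refine Finset.sum_congr rfl fun k _ => ?_
  rw [rDeriv_metric hs hu, Finset.mul_sum, Finset.sum_mul, Finset.sum_mul]
  refine Finset.sum_congr rfl fun l _ => ?_
  ring

/-- Normal coordinates at a point. -/
lemma exists_isNormalCoord {g : EuclideanSpace ℝ (Fin n) → Matrix (Fin n) (Fin n) ℝ}
    (hs : ∀ y i j, g y i j = g y j i) {y₀ : EuclideanSpace ℝ (Fin n)} (hp : (g y₀).PosDef)
    (hd : ∀ i j, DifferentiableAt ℝ (fun y => g y i j) y₀) :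
    ∃ (A : EuclideanSpace ℝ (Fin n) ≃L[ℝ] EuclideanSpace ℝ (Fin n))
      (N : EuclideanSpace ℝ (Fin n) → EuclideanSpace ℝ (Fin n)),
      (∀ y, HasFDerivAt N ((A : EuclideanSpace ℝ (Fin n) →L[ℝ] EuclideanSpace ℝ (Fin n)).comp
        (ContinuousLinearMap.id ℝ _ + christoffelBilin g y₀ (y - y₀))) y) ∧
      IsNormalCoord (quadForm g) N y₀ := by
  obtain ⟨A, hA⟩ := exists_isometry_quadForm g y₀ hp
  set B := christoffelBilin g y₀ with hB
  have hder : ∀ y, HasFDerivAt (fun y => A ((y - y₀) + (1 / 2 : ℝ) • B (y - y₀) (y - y₀)))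
      ((A : EuclideanSpace ℝ (Fin n) →L[ℝ] EuclideanSpace ℝ (Fin n)).comp
        (ContinuousLinearMap.id ℝ _ + B (y - y₀))) y := fun y =>
    (A : EuclideanSpace ℝ (Fin n) →L[ℝ] EuclideanSpace ℝ (Fin n)).hasFDerivAt.comp y
      (hasFDerivAt_sub_add_half_bilin (christoffelBilin_symm hs y₀) y₀ y)
  refine ⟨A, _, hder, ⟨?_, by simp, ⟨A, (hder y₀).congr_fderiv (by ext; simp)⟩, ?_⟩⟩
  · fun_prop
  · intro ε hε
    obtain ⟨K, hK0, hK⟩ : ∃ K > 0, ∀ v, ‖v‖ ^ 2 ≤ K * quadForm g y₀ v := by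
      refine ⟨(‖(A.symm : EuclideanSpace ℝ (Fin n) →L[ℝ] EuclideanSpace ℝ (Fin n))‖ + 1) ^ 2,
        by positivity, fun v => ?_⟩
      rw [← hA, ← mul_pow]
      have h1 := (A.symm : EuclideanSpace ℝ (Fin n) →L[ℝ] EuclideanSpace ℝ (Fin n)).le_opNorm (A v)
      simp only [ContinuousLinearEquiv.coe_coe, ContinuousLinearEquiv.symm_apply_apply] at h1
      gcongr
      nlinarith [norm_nonneg (A v)]
    set C := ‖(A : EuclideanSpace ℝ (Fin n) →L[ℝ] EuclideanSpace ℝ (Fin n))‖ with hC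
    have hb : ∀ w v, quadForm g y₀ (B w v) ≤ (C * ‖B‖) ^ 2 * ‖w‖ ^ 2 * ‖v‖ ^ 2 := by
      intro w v
      rw [← hA]
      have h1 := (A : EuclideanSpace ℝ (Fin n) →L[ℝ] EuclideanSpace ℝ (Fin n)).le_opNorm (B w v)
      have h2 := B.le_opNorm₂ w v
      calc ‖A (B w v)‖ ^ 2 ≤ (C * (‖B‖ * ‖w‖ * ‖v‖)) ^ 2 := by
            gcongr
            exact h1.trans (by gcongr)
        _ = _ := by ring
    have hb0 : ∀ w v, 0 ≤ quadForm g y₀ (B w v) := fun w v => by rw [← hA]; positivity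
    set r : Fin n → Fin n → EuclideanSpace ℝ (Fin n) → ℝ := fun i j y =>
      g y i j - g y₀ i j - fderiv ℝ (fun y => g y i j) y₀ (y - y₀) with hr
    have hro : (fun y => ∑ i, ∑ j, |r i j y|) =o[𝓝 y₀] fun y => y - y₀ :=
      IsLittleO.fun_sum fun i _ => IsLittleO.fun_sum fun j _ =>
        ((hd i j).hasFDerivAt.isLittleO).abs_left
    have hgc : Tendsto (fun y => ∑ i, ∑ j, |g y i j - g y₀ i j|) (𝓝 y₀) (𝓝 0) := by
      have : Tendsto (fun y => ∑ i, ∑ j, |g y i j - g y₀ i j|) (𝓝 y₀)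
          (𝓝 (∑ i, ∑ j, |g y₀ i j - g y₀ i j|)) :=
        tendsto_finsetSum _ fun i _ => tendsto_finsetSum _ fun j _ =>
          (((hd i j).continuousAt.tendsto).sub_const _).abs
      simpa using this
    have hnear : ∀ᶠ y in 𝓝 y₀, (C * ‖B‖) ^ 2 * ‖y - y₀‖ < ε / (4 * K) := by
      have : Tendsto (fun y => (C * ‖B‖) ^ 2 * ‖y - y₀‖) (𝓝 y₀) (𝓝 0) := by
        have h : ContinuousAt (fun y => (C * ‖B‖) ^ 2 * ‖y - y₀‖) y₀ := by fun_prop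
        simpa [ContinuousAt] using h
      exact this.eventually_lt_const (by positivity)
    filter_upwards [hnear, hgc.eventually_lt_const (show 0 < 1 / (2 * K) by positivity),
      hro.def (show 0 < ε / (4 * K) by positivity)] with y h1 h2 h3 v
    set w := y - y₀ with hw
    have hv : ‖v‖ ^ 2 ≤ 2 * K * quadForm g y v := by
      have e : quadForm g y v = quadForm g y₀ v
          + ∑ i, ∑ j, (g y i j - g y₀ i j) * v i * v j := by
        simp only [quadForm, ← Finset.sum_add_distrib]
        refine Finset.sum_congr rfl fun i _ => Finset.sum_congr rfl fun j _ => by ring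
      have h4 := abs_le.1 (abs_sum_mul_mul_le (fun i j => g y i j - g y₀ i j) v)
      have h5 : (∑ i, ∑ j, |g y i j - g y₀ i j|) * ‖v‖ ^ 2 ≤ 1 / (2 * K) * ‖v‖ ^ 2 := by
        gcongr
      have h6 := hK v
      have h7 : K * (1 / (2 * K) * ‖v‖ ^ 2) = ‖v‖ ^ 2 / 2 := by field_simp
      have h8 : quadForm g y₀ v ≤ quadForm g y v + 1 / (2 * K) * ‖v‖ ^ 2 := by linarith [h4.1]
      nlinarith [mul_le_mul_of_nonneg_left h8 hK0.le]
    have hdiff : ‖fderiv ℝ (fun y => A ((y - y₀) + (1 / 2 : ℝ) • B (y - y₀) (y - y₀))) y v‖ ^ 2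
        - quadForm g y v = quadForm g y₀ (B w v) - ∑ i, ∑ j, r i j y * v i * v j := by
      rw [(hder y).fderiv]
      have e1 : ((A : EuclideanSpace ℝ (Fin n) →L[ℝ] EuclideanSpace ℝ (Fin n)).comp
        (ContinuousLinearMap.id ℝ _ + B (y - y₀))) v = A (v + B w v) := by simp [hw]
      rw [e1, hA, quadForm_add g hs, ← sum_fderiv_metric hs hp.isUnit]
      simp only [hr, quadForm, sub_mul, Finset.sum_sub_distrib]
      ring
    rw [hdiff]
    have h9 := abs_sum_mul_mul_le (fun i j => r i j y) v
    have h10 : (∑ i, ∑ j, |r i j y|) ≤ ε / (4 * K) * ‖w‖ := (le_abs_self _).trans h3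
    calc |quadForm g y₀ (B w v) - ∑ i, ∑ j, r i j y * v i * v j|
        ≤ |quadForm g y₀ (B w v)| + |∑ i, ∑ j, r i j y * v i * v j| := abs_sub _ _
      _ ≤ (C * ‖B‖) ^ 2 * ‖w‖ ^ 2 * ‖v‖ ^ 2 + ε / (4 * K) * ‖w‖ * ‖v‖ ^ 2 := by
          rw [abs_of_nonneg (hb0 w v)]
          exact add_le_add (hb w v) (h9.trans (by gcongr))
      _ = ((C * ‖B‖) ^ 2 * ‖w‖ + ε / (4 * K)) * ‖w‖ * ‖v‖ ^ 2 := by ring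
      _ ≤ (ε / (4 * K) + ε / (4 * K)) * ‖w‖ * (2 * K * quadForm g y v) := by gcongr
      _ = ε * ‖w‖ * quadForm g y v := by field_simp; ring

end NormalCoord

section Propagation
open Filter Topology Asymptotics

variable {n m : ℕ}

/-- The second fundamental form of a map into a Riemannian chart. -/
def hessMap {V : Type*} [NormedAddCommGroup V] [NormedSpace ℝ V]
    (g : EuclideanSpace ℝ (Fin n) → Matrix (Fin n) (Fin n) ℝ)
    (F : V → EuclideanSpace ℝ (Fin n)) (z u v : V) : EuclideanSpace ℝ (Fin n) :=
  fderiv ℝ (fderiv ℝ F) z u v + christoffelBilin g (F z) (fderiv ℝ F z u) (fderiv ℝ F z v)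

lemma tendsto_symm_second_difference_comp {V : Type*} [NormedAddCommGroup V] [NormedSpace ℝ V]
    {g : EuclideanSpace ℝ (Fin n) → Matrix (Fin n) (Fin n) ℝ}
    {F : V → EuclideanSpace ℝ (Fin n)} {z : V} (hF : ContDiffAt ℝ 2 F z)
    {A : EuclideanSpace ℝ (Fin n) ≃L[ℝ] EuclideanSpace ℝ (Fin n)}
    {N : EuclideanSpace ℝ (Fin n) → EuclideanSpace ℝ (Fin n)}
    (hN : ∀ y, HasFDerivAt N ((A : EuclideanSpace ℝ (Fin n) →L[ℝ] EuclideanSpace ℝ (Fin n)).comp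
        (ContinuousLinearMap.id ℝ _ + christoffelBilin g (F z) (y - F z))) y)
    (hN0 : N (F z) = 0) {L L' : ℝ → V} {L'' : V} (hL0 : L 0 = z)
    (hL : ∀ᶠ t in 𝓝 0, HasDerivAt L (L' t) t) (hL' : HasDerivAt L' L'' 0) :
    Tendsto (fun t : ℝ => (t ^ 2)⁻¹ • (N (F (L t)) + N (F (L (-t))))) (𝓝[≠] 0)
      (𝓝 (A (hessMap g F z (L' 0) (L' 0) + fderiv ℝ F z L''))) := by
  set B := christoffelBilin g (F z) with hB
  have hLc : ContinuousAt L 0 := hL.self_of_nhds.continuousAt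
  have hFd : ∀ᶠ z' in 𝓝 z, DifferentiableAt ℝ F z' :=
    (hF.eventually (by simp)).mono fun z' h => h.differentiableAt (by simp)
  have hFd' : ∀ᶠ t in 𝓝 0, DifferentiableAt ℝ F (L t) := hLc.eventually (by rwa [hL0])
  have hF' : HasFDerivAt (fderiv ℝ F) (fderiv ℝ (fderiv ℝ F) z) z :=
    ((hF.fderiv_right (m := 1) (by norm_num)).differentiableAt (by simp)).hasFDerivAt
  have hF1 : HasFDerivAt F (fderiv ℝ F z) z := hFd.self_of_nhds.hasFDerivAt
  have hc : HasDerivAt (fun t => F (L t)) (fderiv ℝ F z (L' 0)) 0 :=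
    HasFDerivAt.comp_hasDerivAt (𝕜 := ℝ) (l := F) 0 (by rw [hL0]; exact hF1) hL.self_of_nhds
  have hc' : HasDerivAt (fun t => fderiv ℝ F (L t) (L' t))
      (fderiv ℝ (fderiv ℝ F) z (L' 0) (L' 0) + fderiv ℝ F z L'') 0 := by
    have h1 : HasDerivAt (fun t => fderiv ℝ F (L t)) (fderiv ℝ (fderiv ℝ F) z (L' 0)) 0 :=
      HasFDerivAt.comp_hasDerivAt (𝕜 := ℝ) (l := fderiv ℝ F) 0 (by rw [hL0]; exact hF')
        hL.self_of_nhds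
    have := h1.clm_apply hL'
    rwa [hL0] at this
  have hk : ∀ᶠ t in 𝓝 0, HasDerivAt (fun t => N (F (L t)))
      (A (fderiv ℝ F (L t) (L' t) + B (F (L t) - F z) (fderiv ℝ F (L t) (L' t)))) t := by
    filter_upwards [hFd', hL] with t h1 h2
    have h3 := (hN (F (L t))).comp_hasDerivAt t (h1.hasFDerivAt.comp_hasDerivAt t h2)
    refine h3.congr_deriv ?_
    simp
  have hk' : HasDerivAt (fun t => A (fderiv ℝ F (L t) (L' t)
      + B (F (L t) - F z) (fderiv ℝ F (L t) (L' t))))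
      (A (hessMap g F z (L' 0) (L' 0) + fderiv ℝ F z L'')) 0 := by
    have h1 : HasDerivAt (fun t => B (F (L t) - F z)) (B (fderiv ℝ F z (L' 0))) 0 :=
      B.hasFDerivAt.comp_hasDerivAt 0 (hc.sub_const _)
    have h2 := h1.clm_apply hc'
    have h3 := (A : EuclideanSpace ℝ (Fin n) →L[ℝ] EuclideanSpace ℝ (Fin n)).hasFDerivAt.comp_hasDerivAt
      0 (hc'.add h2)
    refine h3.congr_deriv ?_
    simp only [hL0, sub_self, map_zero, ContinuousLinearEquiv.coe_coe, hessMap, zero_apply,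
      add_zero]
    congr 1
    rw [← hB]
    abel
  have := tendsto_symm_second_difference hk hk'
  simpa [hL0, hN0] using this

/-- The vanishing of the Levi form of a map is invariant under holomorphic changes of the source
coordinates and merely differentiable isometric changes of the target coordinates. -/
lemma hessMap_add_hessMap_I_eq_zero
    {V : Type*} [NormedAddCommGroup V] [NormedSpace ℂ V] [CompleteSpace V]
    {g₁ g₂ : EuclideanSpace ℝ (Fin n) → Matrix (Fin n) (Fin n) ℝ}
    (hs₁ : ∀ y i j, g₁ y i j = g₁ y j i) (hs₂ : ∀ y i j, g₂ y i j = g₂ y j i)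
    {F₁ F₂ : V → EuclideanSpace ℝ (Fin n)} {z₁ z₂ : V}
    (hF₁ : ContDiffAt ℝ 2 F₁ z₁) (hF₂ : ContDiffAt ℝ 2 F₂ z₂)
    (hp₁ : (g₁ (F₁ z₁)).PosDef) (hp₂ : (g₂ (F₂ z₂)).PosDef)
    (hd₁ : ∀ i j, DifferentiableAt ℝ (fun y => g₁ y i j) (F₁ z₁))
    (hd₂ : ∀ i j, DifferentiableAt ℝ (fun y => g₂ y i j) (F₂ z₂))
    {φ : OpenPartialHomeomorph (EuclideanSpace ℝ (Fin n)) (EuclideanSpace ℝ (Fin n))}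
    (hy : F₁ z₁ ∈ φ.source)
    (hφ : ∀ y ∈ φ.source, DifferentiableAt ℝ φ y ∧
      ∀ v, quadForm g₂ (φ y) (fderiv ℝ φ y v) = quadForm g₁ y v)
    (hφ' : ∀ y ∈ φ.target, DifferentiableAt ℝ φ.symm y ∧
      ∀ v, quadForm g₁ (φ.symm y) (fderiv ℝ φ.symm y v) = quadForm g₂ y v)
    {η : V → V} (hη : ∀ᶠ z in 𝓝 z₁, DifferentiableAt ℂ η z) (hη₁ : η z₁ = z₂)
    (hcomm : ∀ᶠ z in 𝓝 z₁, F₂ (η z) = φ (F₁ z))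
    (hpl : ∀ w, hessMap g₂ F₂ z₂ w w + hessMap g₂ F₂ z₂ (I • w) (I • w) = 0) (v : V) :
    hessMap g₁ F₁ z₁ v v + hessMap g₁ F₁ z₁ (I • v) (I • v) = 0 := by
  obtain ⟨A₁, N₁, hN₁, hn₁⟩ := exists_isNormalCoord hs₁ hp₁ hd₁
  obtain ⟨A₂, N₂, hN₂, hn₂⟩ := exists_isNormalCoord hs₂ hp₂ hd₂
  have hFφ : F₂ z₂ = φ (F₁ z₁) := by rw [← hη₁]; exact hcomm.self_of_nhds
  have hline : ∀ w : V, (∀ᶠ t : ℝ in 𝓝 0, HasDerivAt (fun t : ℝ => z₁ + t • w) w t) ∧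
      HasDerivAt (fun _ : ℝ => w) 0 0 := fun w =>
    ⟨Eventually.of_forall fun t => by
      simpa using ((hasDerivAt_id t).smul_const w).const_add z₁, hasDerivAt_const _ _⟩
  have hL : ∀ w : V, Tendsto (fun t : ℝ => (t ^ 2)⁻¹ • (N₁ (F₁ (z₁ + t • w))
      + N₁ (F₁ (z₁ + (-t) • w)))) (𝓝[≠] 0) (𝓝 (A₁ (hessMap g₁ F₁ z₁ w w))) := by
    intro w
    have := tendsto_symm_second_difference_comp hF₁ hN₁ hn₁.map_base (L := fun t : ℝ => z₁ + t • w)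
      (by simp) (hline w).1 (hline w).2
    simpa using this
  have hlc : ∀ w : V, ContinuousAt (fun t : ℝ => z₁ + t • w) 0 := fun w => by fun_prop
  have hlt : ∀ w : V, Tendsto (fun t : ℝ => z₁ + t • w) (𝓝 0) (𝓝 z₁) := fun w => by
    simpa [ContinuousAt] using hlc w
  -- the holomorphic curve
  set l : ℂ → V := fun ζ => η (z₁ + ζ • v) with hl
  have hld : ∀ᶠ ζ in 𝓝 (0 : ℂ), DifferentiableAt ℂ l ζ := by
    have hc : ContinuousAt (fun ζ : ℂ => z₁ + ζ • v) 0 := by fun_prop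
    have hc' : Tendsto (fun ζ : ℂ => z₁ + ζ • v) (𝓝 0) (𝓝 z₁) := by
      simpa [ContinuousAt] using hc
    filter_upwards [hc'.eventually hη] with ζ h
    exact h.comp ζ (by fun_prop)
  have hla : AnalyticAt ℂ l 0 := Complex.analyticAt_iff_eventually_differentiableAt.2 hld
  have hl1 : HasDerivAt (deriv l) (deriv (deriv l) 0) 0 :=
    hla.deriv.differentiableAt.hasDerivAt
  have hcurve : ∀ a : ℂ,
      Tendsto (fun t : ℝ => (t ^ 2)⁻¹ • (N₂ (F₂ (η (z₁ + t • (a • v))))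
        + N₂ (F₂ (η (z₁ + (-t) • (a • v)))))) (𝓝[≠] 0)
        (𝓝 (A₂ (hessMap g₂ F₂ z₂ (a • deriv l 0) (a • deriv l 0)
          + fderiv ℝ F₂ z₂ (a • a • deriv (deriv l) 0)))) := by
    intro a
    have hm : ∀ t : ℝ, HasDerivAt (fun t : ℝ => (t : ℂ) * a) a t := fun t => by
      simpa using (Complex.ofRealCLM.hasDerivAt (x := t)).mul_const a
    have hmt : Tendsto (fun t : ℝ => (t : ℂ) * a) (𝓝 0) (𝓝 0) := by
      have : ContinuousAt (fun t : ℝ => (t : ℂ) * a) 0 := by fun_prop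
      simpa [ContinuousAt] using this
    have h1 : ∀ᶠ t : ℝ in 𝓝 0, HasDerivAt (fun t : ℝ => l ((t : ℂ) * a))
        (a • deriv l ((t : ℂ) * a)) t := by
      filter_upwards [hmt.eventually hld] with t ht
      exact ht.hasDerivAt.scomp t (hm t)
    have h2 : HasDerivAt (fun t : ℝ => a • deriv l ((t : ℂ) * a))
        (a • a • deriv (deriv l) 0) 0 := by
      refine HasDerivAt.const_smul a ?_
      exact HasDerivAt.scomp (𝕜 := ℝ) (𝕜' := ℂ) (g₁ := deriv l) (0 : ℝ) (by simpa using hl1) (hm 0)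
    have := tendsto_symm_second_difference_comp hF₂ hN₂ hn₂.map_base
      (L := fun t : ℝ => l ((t : ℂ) * a)) (by simp [hl, hη₁]) h1 h2
    simpa [hl, mul_smul] using this
  have hsum := (hcurve 1).add (hcurve I)
  have hz : A₂ (hessMap g₂ F₂ z₂ ((1 : ℂ) • deriv l 0) ((1 : ℂ) • deriv l 0)
          + fderiv ℝ F₂ z₂ ((1 : ℂ) • (1 : ℂ) • deriv (deriv l) 0))
        + A₂ (hessMap g₂ F₂ z₂ (I • deriv l 0) (I • deriv l 0)
          + fderiv ℝ F₂ z₂ (I • I • deriv (deriv l) 0)) = 0 := by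
    rw [← map_add]
    have e : fderiv ℝ F₂ z₂ (I • I • deriv (deriv l) 0) = - fderiv ℝ F₂ z₂ (deriv (deriv l) 0) := by
      rw [smul_smul, I_mul_I, neg_one_smul, map_neg]
    rw [e, one_smul, one_smul, one_smul]
    have := hpl (deriv l 0)
    rw [show ∀ a b c d : EuclideanSpace ℝ (Fin n), a + b + (c + -b) = a + c by intros; abel]
    · rw [this, map_zero]
    · exact 0
  rw [hz] at hsum
  have hFd : DifferentiableAt ℝ F₁ z₁ := hF₁.differentiableAt (by simp)
  have hcd : ∀ w : V, DifferentiableAt ℝ (fun t : ℝ => F₁ (z₁ + t • w)) 0 := fun w =>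
    DifferentiableAt.comp (0 : ℝ) (by simpa using hFd) (by fun_prop)
  rw [hFφ] at hn₂
  have key := IsNormalCoord.second_difference_eq_zero (c := fun t : ℝ => F₁ (z₁ + t • v))
    (d := fun t : ℝ => F₁ (z₁ + t • (I • v))) (L := A₁ (hessMap g₁ F₁ z₁ v v)
      + A₁ (hessMap g₁ F₁ z₁ (I • v) (I • v))) hy hn₁ hn₂ hφ hφ' (by simp) (by simp)
    (hcd _) (hcd _) ?_ ?_
  · rw [← map_add] at key
    exact A₁.map_eq_zero_iff.1 key
  · have := (hL v).add (hL (I • v))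
    simpa only [← smul_add] using this
  · refine hsum.congr' ?_
    have hneg : Tendsto (fun t : ℝ => -t) (𝓝 0) (𝓝 0) := by
      simpa using (continuous_neg (G := ℝ)).tendsto 0
    have e1 := (hlt v).eventually hcomm
    have e2 := (hlt (I • v)).eventually hcomm
    filter_upwards [e1.filter_mono nhdsWithin_le_nhds, e2.filter_mono nhdsWithin_le_nhds,
      (hneg.eventually e1).filter_mono nhdsWithin_le_nhds,
      (hneg.eventually e2).filter_mono nhdsWithin_le_nhds] with t a1 a2 a3 a4
    rw [one_smul, a1, a2, a3, a4, ← smul_add]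

end Propagation

section Tension
open Filter Topology Asymptotics

variable {n m : ℕ}

lemma EuclideanSpace.eq_sum_re_im (w : EuclideanSpace ℂ (Fin m)) :
    w = ∑ α, ((w α).re • EuclideanSpace.single α (1 : ℂ) + (w α).im • EuclideanSpace.single α I) := by
  ext β
  simp only [PiLp.add_apply, WithLp.ofLp_sum, Finset.sum_apply, PiLp.smul_apply]
  simp [Finset.sum_add_distrib, Complex.re_add_im]

lemma hasFDerivAt_coe_apply {V : Type*} [NormedAddCommGroup V] [NormedSpace ℝ V]
    {F : V → EuclideanSpace ℝ (Fin n)} {F' : V →L[ℝ] EuclideanSpace ℝ (Fin n)} {z : V}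
    (hF : HasFDerivAt F F' z) (i : Fin n) :
    HasFDerivAt (fun z => ((F z i : ℝ) : ℂ))
      (Complex.ofRealCLM.comp ((EuclideanSpace.proj i : EuclideanSpace ℝ (Fin n) →L[ℝ] ℝ).comp F')) z :=
  Complex.ofRealCLM.hasFDerivAt.comp z
    ((EuclideanSpace.proj i : EuclideanSpace ℝ (Fin n) →L[ℝ] ℝ).hasFDerivAt.comp z hF)

lemma wDerivBar_coe_apply {F : EuclideanSpace ℂ (Fin m) → EuclideanSpace ℝ (Fin n)}
    {z : EuclideanSpace ℂ (Fin m)} (hF : DifferentiableAt ℝ F z) (i : Fin n) (β : Fin m) :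
    wDerivBar β (fun z => ((F z i : ℝ) : ℂ)) z
      = (1 / 2) * (((fderiv ℝ F z (EuclideanSpace.single β 1) i : ℝ) : ℂ)
        + I * ((fderiv ℝ F z (EuclideanSpace.single β I) i : ℝ) : ℂ)) := by
  rw [wDerivBar, (hasFDerivAt_coe_apply hF.hasFDerivAt i).fderiv]
  rfl

lemma wDeriv_coe_apply {F : EuclideanSpace ℂ (Fin m) → EuclideanSpace ℝ (Fin n)}
    {z : EuclideanSpace ℂ (Fin m)} (hF : DifferentiableAt ℝ F z) (i : Fin n) (β : Fin m) :
    wDeriv β (fun z => ((F z i : ℝ) : ℂ)) z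
      = (1 / 2) * (((fderiv ℝ F z (EuclideanSpace.single β 1) i : ℝ) : ℂ)
        - I * ((fderiv ℝ F z (EuclideanSpace.single β I) i : ℝ) : ℂ)) := by
  rw [wDeriv, (hasFDerivAt_coe_apply hF.hasFDerivAt i).fderiv]
  rfl

lemma wDeriv_wDerivBar_coe_apply {F : EuclideanSpace ℂ (Fin m) → EuclideanSpace ℝ (Fin n)}
    {z : EuclideanSpace ℂ (Fin m)} (hF : ContDiffAt ℝ 2 F z) (i : Fin n) (α β : Fin m) :
    wDeriv α (fun z' => wDerivBar β (fun z => ((F z i : ℝ) : ℂ)) z') z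
      = (1 / 4) * (((fderiv ℝ (fderiv ℝ F) z (EuclideanSpace.single α 1)
            (EuclideanSpace.single β 1) i : ℝ) : ℂ)
        + I * ((fderiv ℝ (fderiv ℝ F) z (EuclideanSpace.single α 1)
            (EuclideanSpace.single β I) i : ℝ) : ℂ)
        - I * ((fderiv ℝ (fderiv ℝ F) z (EuclideanSpace.single α I)
            (EuclideanSpace.single β 1) i : ℝ) : ℂ)
        + ((fderiv ℝ (fderiv ℝ F) z (EuclideanSpace.single α I)
            (EuclideanSpace.single β I) i : ℝ) : ℂ)) := by
  have hFd : ∀ᶠ z' in 𝓝 z, DifferentiableAt ℝ F z' :=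
    (hF.eventually (by simp)).mono fun z' h => h.differentiableAt (by simp)
  have hF' : HasFDerivAt (fderiv ℝ F) (fderiv ℝ (fderiv ℝ F) z) z :=
    ((hF.fderiv_right (m := 1) (by norm_num)).differentiableAt (by simp)).hasFDerivAt
  have hd : ∀ u, HasFDerivAt (fun z' => ((fderiv ℝ F z' u i : ℝ) : ℂ))
      (Complex.ofRealCLM.comp ((EuclideanSpace.proj i : EuclideanSpace ℝ (Fin n) →L[ℝ] ℝ).comp
        ((fderiv ℝ (fderiv ℝ F) z).flip u))) z := fun u => by
    refine hasFDerivAt_coe_apply ?_ i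
    refine (hF'.clm_apply (hasFDerivAt_const u z)).congr_fderiv ?_
    ext v
    simp
  have hev : (fun z' => wDerivBar β (fun z => ((F z i : ℝ) : ℂ)) z') =ᶠ[𝓝 z] fun z' =>
      (1 / 2) * (((fderiv ℝ F z' (EuclideanSpace.single β 1) i : ℝ) : ℂ)
        + I * ((fderiv ℝ F z' (EuclideanSpace.single β I) i : ℝ) : ℂ)) := by
    filter_upwards [hFd] with z' h
    exact wDerivBar_coe_apply h i β
  have h1 := ((hd (EuclideanSpace.single β 1)).add
    ((hd (EuclideanSpace.single β I)).const_mul I)).const_mul (1 / 2 : ℂ)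
  rw [wDeriv, hev.fderiv_eq]
  erw [h1.fderiv]
  simp only [_root_.smul_apply, add_apply, ContinuousLinearMap.comp_apply,
    ContinuousLinearMap.flip_apply, Complex.ofRealCLM_apply, PiLp.proj_apply, smul_eq_mul]
  linear_combination (-(1 / 4 : ℂ) * ((fderiv ℝ (fderiv ℝ F) z (EuclideanSpace.single α I)
            (EuclideanSpace.single β I) i : ℝ) : ℂ)) * I_mul_I

lemma hessMap_symm {V : Type*} [NormedAddCommGroup V] [NormedSpace ℝ V]
    {g : EuclideanSpace ℝ (Fin n) → Matrix (Fin n) (Fin n) ℝ} (hs : ∀ y i j, g y i j = g y j i)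
    {F : V → EuclideanSpace ℝ (Fin n)} {z : V} (hF : ContDiffAt ℝ 2 F z) (u v : V) :
    hessMap g F z u v = hessMap g F z v u := by
  rw [hessMap, hessMap, (hF.isSymmSndFDerivAt (by simp)).eq, christoffelBilin_symm hs]

lemma hessMap_apply {V : Type*} [NormedAddCommGroup V] [NormedSpace ℝ V]
    (g : EuclideanSpace ℝ (Fin n) → Matrix (Fin n) (Fin n) ℝ)
    (F : V → EuclideanSpace ℝ (Fin n)) (z u v : V) (i : Fin n) :
    hessMap g F z u v i = fderiv ℝ (fderiv ℝ F) z u v i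
      + ∑ j, ∑ k, christoffel g i j k (F z) * fderiv ℝ F z u j * fderiv ℝ F z v k := by
  rw [hessMap, PiLp.add_apply, christoffelBilin_apply]

/-- The tensor `∂_E ∂̄ f` in terms of the real second fundamental form. -/
lemma wDeriv_wDerivBar_add_christoffel
    {g : EuclideanSpace ℝ (Fin n) → Matrix (Fin n) (Fin n) ℝ} (hs : ∀ y i j, g y i j = g y j i)
    {F : EuclideanSpace ℂ (Fin m) → EuclideanSpace ℝ (Fin n)}
    {z : EuclideanSpace ℂ (Fin m)} (hF : ContDiffAt ℝ 2 F z) (i : Fin n) (α β : Fin m) :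
    wDeriv α (fun z' => wDerivBar β (fun z => ((F z i : ℝ) : ℂ)) z') z
      + ∑ j, ∑ k, (christoffel g i j k (F z) : ℂ) *
        wDerivBar β (fun z => ((F z j : ℝ) : ℂ)) z * wDeriv α (fun z => ((F z k : ℝ) : ℂ)) z
      = (1 / 4) * (((hessMap g F z (EuclideanSpace.single α 1) (EuclideanSpace.single β 1) i
          + hessMap g F z (EuclideanSpace.single α I) (EuclideanSpace.single β I) i : ℝ) : ℂ)
        + I * ((hessMap g F z (EuclideanSpace.single α 1) (EuclideanSpace.single β I) i
          - hessMap g F z (EuclideanSpace.single α I) (EuclideanSpace.single β 1) i : ℝ) : ℂ)) := by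
  have hFd : DifferentiableAt ℝ F z := hF.differentiableAt (by simp)
  rw [wDeriv_wDerivBar_coe_apply hF]
  simp only [wDerivBar_coe_apply hFd, wDeriv_coe_apply hFd]
  rw [hessMap_symm hs hF (EuclideanSpace.single α 1) (EuclideanSpace.single β 1),
    hessMap_symm hs hF (EuclideanSpace.single α I) (EuclideanSpace.single β I),
    hessMap_symm hs hF (EuclideanSpace.single α 1) (EuclideanSpace.single β I),
    hessMap_symm hs hF (EuclideanSpace.single α I) (EuclideanSpace.single β 1)]
  simp only [hessMap_apply, (hF.isSymmSndFDerivAt (by simp)).eq (EuclideanSpace.single β _)]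
  push_cast
  have : ∀ a b c d : EuclideanSpace ℝ (Fin n), ∑ j, ∑ k, (christoffel g i j k (F z) : ℂ) *
        (1 / 2 * ((a j : ℂ) + I * (b j : ℂ))) * (1 / 2 * ((c k : ℂ) - I * (d k : ℂ)))
      = (1 / 4) * (∑ j, ∑ k, (christoffel g i j k (F z) : ℂ) * a j * c k
        + ∑ j, ∑ k, (christoffel g i j k (F z) : ℂ) * b j * d k
        + I * (∑ j, ∑ k, (christoffel g i j k (F z) : ℂ) * b j * c k
        - ∑ j, ∑ k, (christoffel g i j k (F z) : ℂ) * a j * d k)) := by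
    intro a b c d
    simp only [← Finset.sum_add_distrib, ← Finset.sum_sub_distrib, Finset.mul_sum]
    refine Finset.sum_congr rfl fun j _ => Finset.sum_congr rfl fun k _ => ?_
    linear_combination (-(1 / 4 : ℂ) * (christoffel g i j k (F z) : ℂ) * b j * d k) * I_mul_I
  rw [this]
  ring

/-- Pointwise equivalence between the vanishing of `∂_E ∂̄ f` and of the Levi form. -/
lemma forall_levi_eq_zero_iff
    {g : EuclideanSpace ℝ (Fin n) → Matrix (Fin n) (Fin n) ℝ} (hs : ∀ y i j, g y i j = g y j i)
    {F : EuclideanSpace ℂ (Fin m) → EuclideanSpace ℝ (Fin n)}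
    {z : EuclideanSpace ℂ (Fin m)} (hF : ContDiffAt ℝ 2 F z) :
    (∀ (i : Fin n) (α β : Fin m),
      wDeriv α (fun z' => wDerivBar β (fun z => ((F z i : ℝ) : ℂ)) z') z
      + ∑ j, ∑ k, (christoffel g i j k (F z) : ℂ) *
        wDerivBar β (fun z => ((F z j : ℝ) : ℂ)) z * wDeriv α (fun z => ((F z k : ℝ) : ℂ)) z = 0)
    ↔ ∀ w, hessMap g F z w w + hessMap g F z (I • w) (I • w) = 0 := by
  set T : EuclideanSpace ℂ (Fin m) →ₗ[ℝ] EuclideanSpace ℂ (Fin m) →ₗ[ℝ] EuclideanSpace ℝ (Fin n) :=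
    LinearMap.mk₂ ℝ (fun u v => hessMap g F z u v)
      (by intros; simp [hessMap]; abel) (by intros; simp [hessMap])
      (by intros; simp [hessMap]; abel) (by intros; simp [hessMap]) with hT
  set J : EuclideanSpace ℂ (Fin m) →ₗ[ℝ] EuclideanSpace ℂ (Fin m) :=
    (LinearMap.lsmul ℂ (EuclideanSpace ℂ (Fin m)) I).restrictScalars ℝ with hJ
  have hJ1 : ∀ α : Fin m, J (EuclideanSpace.single α 1) = EuclideanSpace.single α I := by
    intro α
    ext β
    by_cases h : β = α <;> simp [hJ, h]
  have hJJ : ∀ w, J (J w) = -w := by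
    intro w
    ext β
    simp [hJ, ← mul_assoc]
  have hJI : ∀ α : Fin m, J (EuclideanSpace.single α I) = -EuclideanSpace.single α 1 := by
    intro α
    rw [← hJ1, hJJ]
  set L := T + T.compl₁₂ J J with hL
  have hLa : ∀ u v, L u v = T u v + T (J u) (J v) := fun u v => by simp [hL]
  have hTs : ∀ u v, T u v = T v u := fun u v => by simpa [hT] using hessMap_symm hs hF u v
  have hLs : ∀ u v, L u v = L v u := fun u v => by rw [hLa, hLa, hTs, hTs (J u)]
  have hLJ : ∀ u v, L (J u) v = - L u (J v) := fun u v => by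
    rw [hLa, hLa, hJJ, hJJ]; simp
  have hten : ∀ i α β, (wDeriv α (fun z' => wDerivBar β (fun z => ((F z i : ℝ) : ℂ)) z') z
      + ∑ j, ∑ k, (christoffel g i j k (F z) : ℂ) *
        wDerivBar β (fun z => ((F z j : ℝ) : ℂ)) z * wDeriv α (fun z => ((F z k : ℝ) : ℂ)) z = 0)
      ↔ L (EuclideanSpace.single α 1) (EuclideanSpace.single β 1) i = 0 ∧
        L (EuclideanSpace.single α 1) (EuclideanSpace.single β I) i = 0 := by
    intro i α β
    rw [wDeriv_wDerivBar_add_christoffel hs hF]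
    have e1 : L (EuclideanSpace.single α 1) (EuclideanSpace.single β 1) i
        = hessMap g F z (EuclideanSpace.single α 1) (EuclideanSpace.single β 1) i
          + hessMap g F z (EuclideanSpace.single α I) (EuclideanSpace.single β I) i := by
      rw [hLa, hJ1, hJ1]; simp [hT]
    have e2 : L (EuclideanSpace.single α 1) (EuclideanSpace.single β I) i
        = hessMap g F z (EuclideanSpace.single α 1) (EuclideanSpace.single β I) i
          - hessMap g F z (EuclideanSpace.single α I) (EuclideanSpace.single β 1) i := by
      rw [hLa, hJ1, hJI, map_neg]; simp [hT, sub_eq_add_neg]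
    rw [e1, e2, Complex.ext_iff]
    simp
  have hdiag : (∀ w, hessMap g F z w w + hessMap g F z (I • w) (I • w) = 0) ↔ ∀ w, L w w = 0 :=
    forall_congr' fun w => by rw [hLa]; rfl
  rw [hdiag]
  simp only [hten]
  constructor
  · intro h w
    have h11 : ∀ α β : Fin m, L (EuclideanSpace.single α 1) (EuclideanSpace.single β 1) = 0 :=
      fun α β => by ext i; exact (h i α β).1
    have h1I : ∀ α β : Fin m, L (EuclideanSpace.single α 1) (EuclideanSpace.single β I) = 0 :=
      fun α β => by ext i; exact (h i α β).2
    have hI1 : ∀ α β : Fin m, L (EuclideanSpace.single α I) (EuclideanSpace.single β 1) = 0 :=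
      fun α β => by rw [hLs, h1I]
    have hII : ∀ α β : Fin m, L (EuclideanSpace.single α I) (EuclideanSpace.single β I) = 0 :=
      fun α β => by rw [← hJ1 α, hLJ, hJI, map_neg, h11]; simp
    have key : ∀ u v, L u v = 0 := by
      intro u v
      rw [EuclideanSpace.eq_sum_re_im u, EuclideanSpace.eq_sum_re_im v]
      simp only [map_sum, map_add, map_smul, LinearMap.sum_apply, LinearMap.add_apply,
        LinearMap.smul_apply, h11, h1I, hI1, hII]
      simp
    exact key w w
  · intro h
    have key : ∀ u v, L u v = 0 := by
      intro u v
      have h1 := h (u + v)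
      simp only [map_add, LinearMap.add_apply, h, zero_add, add_zero] at h1
      rw [hLs v u, ← two_smul ℝ] at h1
      simpa using h1
    intro i α β
    simp [key]

end Tension

section Transition
open Filter Topology Asymptotics

variable {m n : ℕ} {M N : Type*} [TopologicalSpace M]
  [ChartedSpace (EuclideanSpace ℂ (Fin m)) M]
  [TopologicalSpace N] [ChartedSpace (EuclideanSpace ℝ (Fin n)) N]

lemma RiemannData.posDef (gD : RiemannData n N) {p : N} {y : EuclideanSpace ℝ (Fin n)}
    (hy : y ∈ (chartAt (EuclideanSpace ℝ (Fin n)) p).target) : (gD.g p y).PosDef :=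
  posDef_of_quadForm_pos (gD.symm p y) (gD.posdef p y hy)

lemma RiemannData.contDiffAt (gD : RiemannData n N) {p : N} {y : EuclideanSpace ℝ (Fin n)}
    (hy : y ∈ (chartAt (EuclideanSpace ℝ (Fin n)) p).target) (i j : Fin n) :
    ContDiffAt ℝ (⊤ : ℕ∞) (fun y => gD.g p y i j) y :=
  (gD.smooth p i j).contDiffAt ((chartAt _ p).open_target.mem_nhds hy)

lemma HermitianData.contDiffAt (hD : HermitianData m M) {p : M} {z : EuclideanSpace ℂ (Fin m)}
    (hz : z ∈ (chartAt (EuclideanSpace ℂ (Fin m)) p).target) (α β : Fin m) :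
    ContDiffAt ℝ (⊤ : ℕ∞) (fun z => hD.h p z α β) z :=
  (hD.smooth p α β).contDiffAt ((chartAt _ p).open_target.mem_nhds hz)

/-- Changes of charts are isometries, in particular differentiable. -/
lemma RiemannData.quadForm_transition (gD : RiemannData n N) [NeZero n] (p q : N)
    {y : EuclideanSpace ℝ (Fin n)}
    (hy : y ∈ ((chartAt (EuclideanSpace ℝ (Fin n)) p).symm.trans
            (chartAt (EuclideanSpace ℝ (Fin n)) q)).source) :
    DifferentiableAt ℝ ((chartAt (EuclideanSpace ℝ (Fin n)) p).symm.trans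
            (chartAt (EuclideanSpace ℝ (Fin n)) q)) y ∧
      ∀ v, quadForm (gD.g q) (((chartAt (EuclideanSpace ℝ (Fin n)) p).symm.trans
            (chartAt (EuclideanSpace ℝ (Fin n)) q)) y)
          (fderiv ℝ ((chartAt (EuclideanSpace ℝ (Fin n)) p).symm.trans
            (chartAt (EuclideanSpace ℝ (Fin n)) q)) y v) = quadForm (gD.g p) y v := by
  have hc := gD.compat p q y hy
  set φ := (chartAt (EuclideanSpace ℝ (Fin n)) p).symm.trans
            (chartAt (EuclideanSpace ℝ (Fin n)) q) with hφ
  have hyt : y ∈ (chartAt (EuclideanSpace ℝ (Fin n)) p).target := by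
    have := hy
    simp only [hφ, mfld_simps] at this
    exact this.1
  constructor
  · by_contra hnd
    have h0 := (gD.posDef hyt).diag_pos (i := (0 : Fin n))
    rw [hc 0 0, fderiv_zero_of_not_differentiableAt hnd] at h0
    simp at h0
  · intro v
    have hv : ∀ k, fderiv ℝ φ y v k = ∑ i, v i * fderiv ℝ φ y (EuclideanSpace.single i 1) k := by
      intro k
      have hw : v = ∑ i, v i • EuclideanSpace.single i (1 : ℝ) := by
        ext i
        simp [Pi.single_apply]
      conv_lhs => rw [hw]
      simp
    simp only [quadForm, hv, hc, Finset.mul_sum, Finset.sum_mul]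
    calc ∑ k, ∑ l, ∑ j, ∑ i, gD.g q (φ y) k l * (v i * fderiv ℝ φ y (EuclideanSpace.single i 1) k) *
          (v j * fderiv ℝ φ y (EuclideanSpace.single j 1) l)
        = ∑ k, ∑ j, ∑ l, ∑ i, gD.g q (φ y) k l *
            (v i * fderiv ℝ φ y (EuclideanSpace.single i 1) k) *
            (v j * fderiv ℝ φ y (EuclideanSpace.single j 1) l) :=
          Finset.sum_congr rfl fun _ _ => Finset.sum_comm
      _ = ∑ k, ∑ j, ∑ i, ∑ l, gD.g q (φ y) k l *
            (v i * fderiv ℝ φ y (EuclideanSpace.single i 1) k) *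
            (v j * fderiv ℝ φ y (EuclideanSpace.single j 1) l) :=
          Finset.sum_congr rfl fun _ _ => Finset.sum_congr rfl fun _ _ => Finset.sum_comm
      _ = ∑ j, ∑ k, ∑ i, ∑ l, gD.g q (φ y) k l *
            (v i * fderiv ℝ φ y (EuclideanSpace.single i 1) k) *
            (v j * fderiv ℝ φ y (EuclideanSpace.single j 1) l) := Finset.sum_comm
      _ = ∑ j, ∑ i, ∑ k, ∑ l, gD.g q (φ y) k l *
            (v i * fderiv ℝ φ y (EuclideanSpace.single i 1) k) *
            (v j * fderiv ℝ φ y (EuclideanSpace.single j 1) l) :=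
          Finset.sum_congr rfl fun _ _ => Finset.sum_comm
      _ = ∑ i, ∑ j, ∑ k, ∑ l, gD.g q (φ y) k l *
            (v i * fderiv ℝ φ y (EuclideanSpace.single i 1) k) *
            (v j * fderiv ℝ φ y (EuclideanSpace.single j 1) l) := Finset.sum_comm
      _ = _ := by
          refine Finset.sum_congr rfl fun i _ => Finset.sum_congr rfl fun j _ =>
            Finset.sum_congr rfl fun k _ => Finset.sum_congr rfl fun l _ => by ring

lemma HermitianData.diag_ne_zero (hD : HermitianData m M) {p : M} {z : EuclideanSpace ℂ (Fin m)}
    (hz : z ∈ (chartAt (EuclideanSpace ℂ (Fin m)) p).target) (α : Fin m) :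
    hD.h p z α α ≠ 0 := by
  have h := hD.posdef p z hz (Pi.single α 1) (by simp)
  simp [Pi.single_apply] at h
  exact ne_of_gt h

/-- Changes of charts are holomorphic. -/
lemma HermitianData.differentiableAt_transition (hD : HermitianData m M) [NeZero m] (p q : M)
    {z : EuclideanSpace ℂ (Fin m)}
    (hz : z ∈ ((chartAt (EuclideanSpace ℂ (Fin m)) p).symm.trans
            (chartAt (EuclideanSpace ℂ (Fin m)) q)).source) :
    DifferentiableAt ℂ ((chartAt (EuclideanSpace ℂ (Fin m)) p).symm.trans
            (chartAt (EuclideanSpace ℂ (Fin m)) q)) z := by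
  have hc := hD.compat p q z hz 0 0
  by_contra hnd
  have hzt : z ∈ (chartAt (EuclideanSpace ℂ (Fin m)) p).target := by
    have := hz
    simp only [mfld_simps] at this
    exact this.1
  refine hD.diag_ne_zero hzt 0 ?_
  rw [hc, fderiv_zero_of_not_differentiableAt hnd]
  simp

lemma IsSmoothMap.contDiffAt_chartRep {f : M → N} (hf : IsSmoothMap (m := m) (n := n) f) (p : M) :
    ContDiffAt ℝ (⊤ : ℕ∞) (chartRep (m := m) (n := n) f p) (basePt p) := by
  have h := (contMDiffAt_iff.1 (hf p)).2
  simp only [mfld_simps] at h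
  exact h.contDiffAt univ_mem

/-- Pluriharmonicity, assumed at the base point of every preferred chart, holds near the base
point of each preferred chart. -/
lemma IsPluriHarmonic.eventually (hD : HermitianData m M) {gD : RiemannData n N} {f : M → N}
    (hf : IsSmoothMap (m := m) (n := n) f) (hpl : IsPluriHarmonic (m := m) gD f) (p : M) :
    ∀ᶠ z in 𝓝 (basePt (m := m) p), ∀ (i : Fin n) (α β : Fin m), pluriTensor gD f p i α β z = 0 := by
  rcases Nat.eq_zero_or_pos m with rfl | hm
  · exact Eventually.of_forall fun z i α => α.elim0
  rcases Nat.eq_zero_or_pos n with rfl | hn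
  · exact Eventually.of_forall fun z i => i.elim0
  have : NeZero m := ⟨hm.ne'⟩
  have : NeZero n := ⟨hn.ne'⟩
  have hfc : Continuous f := hf.continuous
  set cp := chartAt (EuclideanSpace ℂ (Fin m)) p with hcp
  set cfp := chartAt (EuclideanSpace ℝ (Fin n)) (f p) with hcfp
  have hbt : basePt p ∈ cp.target := mem_chart_target _ p
  have hsm : ∀ᶠ z in 𝓝 (basePt (m := m) p), ContDiffAt ℝ 2 (chartRep (m := m) (n := n) f p) z :=
    ((hf.contDiffAt_chartRep p).of_le ENat.LEInfty.out).eventually (by simp)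
  have hdom : ∀ᶠ z in 𝓝 (basePt (m := m) p), z ∈ cp.target ∧ f (cp.symm z) ∈ cfp.source := by
    refine Eventually.and (cp.open_target.mem_nhds hbt) ?_
    have hc : ContinuousAt (fun z => f (cp.symm z)) (basePt p) :=
      hfc.continuousAt.comp (cp.continuousAt_symm hbt)
    refine hc.eventually (cfp.open_source.mem_nhds ?_)
    change f (cp.symm (cp p)) ∈ cfp.source
    rw [cp.left_inv (mem_chart_source _ p)]
    exact mem_chart_source _ (f p)
  filter_upwards [hsm, hdom.eventually_nhds] with z₁ hz₁ hdomz
  have hz₁t := hdomz.self_of_nhds.1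
  have hz₁f := hdomz.self_of_nhds.2
  set q := cp.symm z₁ with hq
  set cq := chartAt (EuclideanSpace ℂ (Fin m)) q with hcq
  set cfq := chartAt (EuclideanSpace ℝ (Fin n)) (f q) with hcfq
  have hF₁ : ∀ z, chartRep (m := m) (n := n) f p z = cfp (f (cp.symm z)) := fun _ => rfl
  have hF₂ : ∀ z, chartRep (m := m) (n := n) f q z = cfq (f (cq.symm z)) := fun _ => rfl
  have hF₂b : chartRep (m := m) (n := n) f q (basePt q) = cfq (f q) := by
    rw [hF₂, basePt, cq.left_inv (mem_chart_source _ q)]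
  have hy₁ : chartRep (m := m) (n := n) f p z₁ ∈ cfp.target := cfp.map_source hz₁f
  have hy₂ : chartRep (m := m) (n := n) f q (basePt q) ∈ cfq.target := by
    rw [hF₂b]; exact mem_chart_target _ (f q)
  have hF₂s : ContDiffAt ℝ 2 (chartRep (m := m) (n := n) f q) (basePt q) :=
    (hf.contDiffAt_chartRep q).of_le ENat.LEInfty.out
  have hsrc : z₁ ∈ (cp.symm.trans cq).source := by
    simp only [mfld_simps]
    exact ⟨hz₁t, mem_chart_source _ q⟩
  refine (forall_levi_eq_zero_iff (gD.symm (f p)) hz₁).2 ?_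
  refine hessMap_add_hessMap_I_eq_zero (gD.symm (f p)) (gD.symm (f q)) hz₁ hF₂s
    (gD.posDef hy₁) (gD.posDef hy₂)
    (fun i j => (gD.contDiffAt hy₁ i j).differentiableAt (by simp))
    (fun i j => (gD.contDiffAt hy₂ i j).differentiableAt (by simp))
    (φ := cfp.symm.trans cfq) ?_
    (fun y hy => gD.quadForm_transition (f p) (f q) hy)
    (fun y hy => gD.quadForm_transition (f q) (f p) ?_)
    (η := cp.symm.trans cq) ?_ ?_ ?_
    ((forall_levi_eq_zero_iff (gD.symm (f q)) hF₂s).1 (hpl q))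
  · simp only [mfld_simps]
    refine ⟨hy₁, ?_⟩
    rw [hF₁, cfp.left_inv hz₁f]
    exact mem_chart_source _ (f q)
  · rw [← OpenPartialHomeomorph.symm_source, OpenPartialHomeomorph.trans_symm_eq_symm_trans_symm,
      OpenPartialHomeomorph.symm_symm] at hy
    exact hy
  · filter_upwards [(cp.symm.trans cq).open_source.mem_nhds hsrc] with z hz
    exact hD.differentiableAt_transition p q hz
  · rfl
  · filter_upwards [(cp.symm.trans cq).open_source.mem_nhds hsrc, hdomz] with z hz hzd
    simp only [mfld_simps] at hz
    rw [hF₂, hF₁]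
    simp only [mfld_simps]
    rw [cq.left_inv hz.2, cfp.left_inv hzd.2]

end Transition

section Wirtinger
open Filter Topology Asymptotics

variable {n m : ℕ}

/-- Common form `½ (∂_{x^α} + σ ∂_{y^α})` of the two Wirtinger derivatives. -/
def wirt (σ : ℂ) (α : Fin m) (F : EuclideanSpace ℂ (Fin m) → ℂ)
    (z : EuclideanSpace ℂ (Fin m)) : ℂ :=
  (1 / 2) * (fderiv ℝ F z (EuclideanSpace.single α 1)
    + σ * fderiv ℝ F z (EuclideanSpace.single α I))

lemma wDeriv_eq_wirt (α : Fin m) : wDeriv α = wirt (-I) α := by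
  funext F z
  simp [wDeriv, wirt, sub_eq_add_neg]

lemma wDerivBar_eq_wirt (α : Fin m) : wDerivBar α = wirt I α := rfl

variable {σ τ : ℂ} {α β : Fin m} {F G : EuclideanSpace ℂ (Fin m) → ℂ}
  {z : EuclideanSpace ℂ (Fin m)}

lemma wirt_congr (h : F =ᶠ[𝓝 z] G) : wirt σ α F z = wirt σ α G z := by
  rw [wirt, wirt, h.fderiv_eq]

lemma wirt_const (c : ℂ) : wirt σ α (fun _ => c) z = 0 := by simp [wirt]

lemma wirt_add (hF : DifferentiableAt ℝ F z) (hG : DifferentiableAt ℝ G z) :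
    wirt σ α (fun z => F z + G z) z = wirt σ α F z + wirt σ α G z := by
  rw [wirt, fderiv_fun_add hF hG]
  simp only [wirt, add_apply]
  ring

lemma wirt_sub (hF : DifferentiableAt ℝ F z) (hG : DifferentiableAt ℝ G z) :
    wirt σ α (fun z => F z - G z) z = wirt σ α F z - wirt σ α G z := by
  rw [wirt, fderiv_fun_sub hF hG]
  simp only [wirt, _root_.sub_apply]
  ring

lemma wirt_neg : wirt σ α (fun z => - F z) z = - wirt σ α F z := by
  rw [wirt, fderiv_fun_neg]
  simp only [wirt, _root_.neg_apply]
  ring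

lemma wirt_mul (hF : DifferentiableAt ℝ F z) (hG : DifferentiableAt ℝ G z) :
    wirt σ α (fun z => F z * G z) z = wirt σ α F z * G z + F z * wirt σ α G z := by
  rw [wirt, fderiv_fun_mul hF hG]
  simp only [wirt, add_apply, _root_.smul_apply, smul_eq_mul]
  ring

lemma wirt_sum {ι : Type*} {s : Finset ι} {F : ι → EuclideanSpace ℂ (Fin m) → ℂ}
    (hF : ∀ i ∈ s, DifferentiableAt ℝ (F i) z) :
    wirt σ α (fun z => ∑ i ∈ s, F i z) z = ∑ i ∈ s, wirt σ α (F i) z := by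
  rw [wirt, fderiv_fun_sum hF]
  simp only [wirt, Finset.mul_sum, _root_.sum_apply, ← Finset.sum_add_distrib]

lemma conj_wirt : (starRingEnd ℂ) (wirt σ α F z)
    = wirt ((starRingEnd ℂ) σ) α (fun z => (starRingEnd ℂ) (F z)) z := by
  have h : ∀ u, fderiv ℝ (fun z => (starRingEnd ℂ) (F z)) z u = (starRingEnd ℂ) (fderiv ℝ F z u) := by
    intro u
    have := Complex.conjCLE.comp_fderiv (f := F) (x := z)
    have e : (fun z => (starRingEnd ℂ) (F z)) = Complex.conjCLE ∘ F := rfl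
    rw [e, this]
    rfl
  simp [wirt, h, map_ofNat]

lemma conj_wirt_coe {f : EuclideanSpace ℂ (Fin m) → ℝ} :
    (starRingEnd ℂ) (wirt σ α (fun z => (f z : ℂ)) z)
      = wirt ((starRingEnd ℂ) σ) α (fun z => (f z : ℂ)) z := by
  rw [conj_wirt]
  simp

lemma ContDiffAt.wirt {k : ℕ} (hF : ContDiffAt ℝ (k + 1 : ℕ) F z) :
    ContDiffAt ℝ k (wirt σ α F) z := by
  have h : ContDiffAt ℝ k (fderiv ℝ F) z := hF.fderiv_right (by norm_cast)
  unfold _root_.wirt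
  exact contDiffAt_const.mul ((h.clm_apply contDiffAt_const).add
    (contDiffAt_const.mul (h.clm_apply contDiffAt_const)))

lemma wirt_comm (hF : ContDiffAt ℝ 2 F z) :
    wirt σ α (wirt τ β F) z = wirt τ β (wirt σ α F) z := by
  have h : DifferentiableAt ℝ (fderiv ℝ F) z :=
    (hF.fderiv_right (m := 1) (by norm_num)).differentiableAt (by simp)
  have hs := (hF.isSymmSndFDerivAt (by simp)).eq
  have key : ∀ (τ : ℂ) (β : Fin m) u, fderiv ℝ (wirt τ β F) z u
      = (1 / 2) * (fderiv ℝ (fderiv ℝ F) z u (EuclideanSpace.single β 1)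
        + τ * fderiv ℝ (fderiv ℝ F) z u (EuclideanSpace.single β I)) := by
    intro τ β u
    have hd : ∀ v, HasFDerivAt (fun z => fderiv ℝ F z v) ((fderiv ℝ (fderiv ℝ F) z).flip v) z := by
      intro v
      refine (h.hasFDerivAt.clm_apply (hasFDerivAt_const v z)).congr_fderiv ?_
      ext v
      simp
    have := ((hd (EuclideanSpace.single β 1)).add
      ((hd (EuclideanSpace.single β I)).const_mul τ)).const_mul (1 / 2 : ℂ)
    have e := this.fderiv
    unfold wirt
    erw [e]
    rfl
  rw [wirt, wirt, key, key, key, key, hs (EuclideanSpace.single α 1), hs (EuclideanSpace.single α I),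
    hs (EuclideanSpace.single α 1), hs (EuclideanSpace.single α I)]
  ring

lemma wirt_coe_comp {φ : EuclideanSpace ℝ (Fin n) → ℝ}
    {f : EuclideanSpace ℂ (Fin m) → EuclideanSpace ℝ (Fin n)}
    (hφ : DifferentiableAt ℝ φ (f z)) (hf : DifferentiableAt ℝ f z) :
    wirt σ α (fun z => (φ (f z) : ℂ)) z
      = ∑ k, (rDeriv k φ (f z) : ℂ) * wirt σ α (fun z => ((f z k : ℝ) : ℂ)) z := by
  have h1 : ∀ u, fderiv ℝ (fun z => (φ (f z) : ℂ)) z u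
      = ∑ k, (rDeriv k φ (f z) : ℂ) * ((fderiv ℝ f z u k : ℝ) : ℂ) := by
    intro u
    have := (Complex.ofRealCLM.hasFDerivAt (x := φ (f z))).comp z
      (hφ.hasFDerivAt.comp z hf.hasFDerivAt)
    have e := this.fderiv
    have e2 : (fun z => (φ (f z) : ℂ)) = Complex.ofRealCLM ∘ φ ∘ f := rfl
    rw [e2, e]
    simp only [ContinuousLinearMap.comp_apply, Complex.ofRealCLM_apply]
    rw [fderiv_apply_eq_sum_rDeriv]
    push_cast
    exact Finset.sum_congr rfl fun k _ => mul_comm _ _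
  have h2 : ∀ k u, fderiv ℝ (fun z => ((f z k : ℝ) : ℂ)) z u = ((fderiv ℝ f z u k : ℝ) : ℂ) := by
    intro k u
    rw [(hasFDerivAt_coe_apply hf.hasFDerivAt k).fderiv]
    rfl
  simp only [wirt, h1, h2, Finset.mul_sum, ← Finset.sum_add_distrib]
  exact Finset.sum_congr rfl fun k _ => by ring

end Wirtinger

section MatrixInverse
open Matrix

lemma ContDiffAt.matrix_det {ι 𝕜 V : Type*} [Fintype ι] [DecidableEq ι] [NormedField 𝕜]
    [NormedAlgebra ℝ 𝕜] [NormedAddCommGroup V] [NormedSpace ℝ V] {k : WithTop ℕ∞}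
    {A : V → Matrix ι ι 𝕜} {x : V} (hA : ∀ i j, ContDiffAt ℝ k (fun y => A y i j) x) :
    ContDiffAt ℝ k (fun y => (A y).det) x := by
  simp only [Matrix.det_apply]
  refine ContDiffAt.sum fun σ _ => ContDiffAt.const_smul _ ?_
  exact contDiffAt_prod fun i _ => hA _ _

lemma ContDiffAt.matrix_inv {ι 𝕜 V : Type*} [Fintype ι] [DecidableEq ι] [NormedField 𝕜]
    [NormedAlgebra ℝ 𝕜] [NormedAddCommGroup V] [NormedSpace ℝ V] {k : WithTop ℕ∞}
    {A : V → Matrix ι ι 𝕜} {x : V} (hA : ∀ i j, ContDiffAt ℝ k (fun y => A y i j) x)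
    (hx : (A x).det ≠ 0) (i j : ι) :
    ContDiffAt ℝ k (fun y => (A y)⁻¹ i j) x := by
  simp only [Matrix.inv_def, Ring.inverse_eq_inv', Matrix.smul_apply, smul_eq_mul,
    Matrix.adjugate_apply]
  refine ((ContDiffAt.matrix_det hA).inv hx).mul (ContDiffAt.matrix_det fun a b => ?_)
  by_cases h : a = j
  · subst h
    simpa using contDiffAt_const
  · simpa [Matrix.updateRow_ne h] using hA a b

end MatrixInverse

section Riemann
open Filter Topology

variable {n : ℕ}

lemma ContDiffAt.rDeriv {k : ℕ} {φ : EuclideanSpace ℝ (Fin n) → ℝ} {y : EuclideanSpace ℝ (Fin n)}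
    (hφ : ContDiffAt ℝ (k + 1 : ℕ) φ y) (i : Fin n) : ContDiffAt ℝ k (rDeriv i φ) y := by
  have h : ContDiffAt ℝ k (fderiv ℝ φ) y := hφ.fderiv_right (by norm_cast)
  exact h.clm_apply contDiffAt_const

lemma rDeriv_comm {φ : EuclideanSpace ℝ (Fin n) → ℝ} {y : EuclideanSpace ℝ (Fin n)}
    (hφ : ContDiffAt ℝ 2 φ y) (i j : Fin n) :
    rDeriv i (rDeriv j φ) y = rDeriv j (rDeriv i φ) y := by
  have h : DifferentiableAt ℝ (fderiv ℝ φ) y :=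
    (hφ.fderiv_right (m := 1) (by norm_num)).differentiableAt (by simp)
  have key : ∀ (k : Fin n) u, fderiv ℝ (rDeriv k φ) y u
      = fderiv ℝ (fderiv ℝ φ) y u (EuclideanSpace.single k 1) := by
    intro k u
    have := (h.hasFDerivAt.clm_apply (hasFDerivAt_const (EuclideanSpace.single k (1 : ℝ)) y)).fderiv
    unfold rDeriv
    rw [this]
    simp
  rw [rDeriv, rDeriv, key, key, (hφ.isSymmSndFDerivAt (by simp)).eq]

lemma rDeriv_congr {φ ψ : EuclideanSpace ℝ (Fin n) → ℝ} {y : EuclideanSpace ℝ (Fin n)}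
    (h : φ =ᶠ[𝓝 y] ψ) (i : Fin n) : rDeriv i φ y = rDeriv i ψ y := by
  rw [rDeriv, rDeriv, h.fderiv_eq]

lemma rDeriv_sum {ι : Type*} {s : Finset ι} {φ : ι → EuclideanSpace ℝ (Fin n) → ℝ}
    {y : EuclideanSpace ℝ (Fin n)} (hφ : ∀ a ∈ s, DifferentiableAt ℝ (φ a) y) (i : Fin n) :
    rDeriv i (fun y => ∑ a ∈ s, φ a y) y = ∑ a ∈ s, rDeriv i (φ a) y := by
  rw [rDeriv, fderiv_fun_sum hφ]
  simp [rDeriv]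

lemma rDeriv_add {φ ψ : EuclideanSpace ℝ (Fin n) → ℝ} {y : EuclideanSpace ℝ (Fin n)}
    (hφ : DifferentiableAt ℝ φ y) (hψ : DifferentiableAt ℝ ψ y) (i : Fin n) :
    rDeriv i (fun y => φ y + ψ y) y = rDeriv i φ y + rDeriv i ψ y := by
  rw [rDeriv, fderiv_fun_add hφ hψ]
  rfl

lemma rDeriv_mul {φ ψ : EuclideanSpace ℝ (Fin n) → ℝ} {y : EuclideanSpace ℝ (Fin n)}
    (hφ : DifferentiableAt ℝ φ y) (hψ : DifferentiableAt ℝ ψ y) (i : Fin n) :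
    rDeriv i (fun y => φ y * ψ y) y = rDeriv i φ y * ψ y + φ y * rDeriv i ψ y := by
  rw [rDeriv, fderiv_fun_mul hφ hψ]
  simp [rDeriv]
  ring

lemma ContDiffAt.christoffel {g : EuclideanSpace ℝ (Fin n) → Matrix (Fin n) (Fin n) ℝ}
    {y : EuclideanSpace ℝ (Fin n)} {k : ℕ}
    (hg : ∀ i j, ContDiffAt ℝ (k + 1 : ℕ) (fun y => g y i j) y) (hu : (g y).det ≠ 0)
    (a b c : Fin n) : ContDiffAt ℝ k (christoffel g a b c) y := by
  have hg' : ∀ i j, ContDiffAt ℝ k (fun y => g y i j) y := fun i j =>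
    (hg i j).of_le (by norm_cast; omega)
  unfold _root_.christoffel
  refine contDiffAt_const.mul (ContDiffAt.sum fun l _ => ?_)
  exact (ContDiffAt.matrix_inv hg' hu a l).mul
    ((((hg c l).rDeriv b).add ((hg b l).rDeriv c)).sub ((hg b c).rDeriv l))

/-- The Riemann curvature tensor is antisymmetric in its last two arguments. -/
lemma riemannLo_antisymm {g : EuclideanSpace ℝ (Fin n) → Matrix (Fin n) (Fin n) ℝ}
    (hs : ∀ y i j, g y i j = g y j i) {y : EuclideanSpace ℝ (Fin n)}
    (hg : ∀ i j, ContDiffAt ℝ 2 (fun y => g y i j) y) (hu : (g y).det ≠ 0)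
    (i j k l : Fin n) : riemannLo g i j k l y = - riemannLo g i j l k y := by
  have hgd : ∀ a b, DifferentiableAt ℝ (fun y => g y a b) y := fun a b =>
    (hg a b).differentiableAt (by simp)
  have hGd : ∀ a b c, DifferentiableAt ℝ (christoffel g a b c) y := fun a b c =>
    (ContDiffAt.christoffel (k := 1) (by simpa using hg) hu a b c).differentiableAt (by simp)
  have hdet : ∀ᶠ y' in 𝓝 y, (g y').det ≠ 0 :=
    (ContDiffAt.matrix_det (k := 0) fun a b => (hg a b).of_le (by simp)).continuousAt.eventually_ne hu
  have hmet : ∀ j k l, rDeriv j (fun y => g y k l) =ᶠ[𝓝 y] fun y =>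
      ∑ p, (christoffel g p j k y * g y p l + christoffel g p j l y * g y p k) := by
    intro j k l
    filter_upwards [hdet] with y' h
    rw [rDeriv_metric hs ((Matrix.isUnit_iff_isUnit_det _).2 (isUnit_iff_ne_zero.2 h)) k l j]
    exact Finset.sum_congr rfl fun p _ => by rw [hs y' k p]
  have h2 : ∀ i j, rDeriv i (rDeriv j (fun y => g y k l)) y
      = ∑ p, rDeriv i (christoffel g p j k) y * g y p l
        + ∑ p, rDeriv i (christoffel g p j l) y * g y p k
        + ∑ p, ∑ q, christoffel g p j k y * (christoffel g q i p y * g y q l)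
        + ∑ p, ∑ q, christoffel g p j k y * (christoffel g q i l y * g y q p)
        + ∑ p, ∑ q, christoffel g p j l y * (christoffel g q i k y * g y q p)
        + ∑ p, ∑ q, christoffel g p j l y * (christoffel g q i p y * g y q k) := by
    intro i j
    have hm1 : ∀ p, DifferentiableAt ℝ (fun y => christoffel g p j k y * g y p l) y :=
      fun p => (hGd _ _ _).fun_mul (hgd _ _)
    have hm2 : ∀ p, DifferentiableAt ℝ (fun y => christoffel g p j l y * g y p k) y :=
      fun p => (hGd _ _ _).fun_mul (hgd _ _)
    rw [rDeriv_congr (hmet j k l), rDeriv_sum (φ := fun p y => christoffel g p j k y * g y p l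
      + christoffel g p j l y * g y p k) fun p _ => (hm1 p).fun_add (hm2 p)]
    simp only [← Finset.sum_add_distrib]
    refine Finset.sum_congr rfl fun p _ => ?_
    rw [rDeriv_add (hm1 p) (hm2 p), rDeriv_mul (hGd _ _ _) (hgd _ _),
      rDeriv_mul (hGd _ _ _) (hgd _ _), (hmet i p l).self_of_nhds, (hmet i p k).self_of_nhds]
    simp only [Finset.mul_sum, mul_add, Finset.sum_add_distrib]
    ring
  have hcomm := rDeriv_comm (hg k l) i j
  rw [h2 i j, h2 j i] at hcomm
  have hR : ∀ k l, riemannLo g i j k l y = ∑ p, rDeriv i (christoffel g p j k) y * g y p l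
        - ∑ p, rDeriv j (christoffel g p i k) y * g y p l
      + ∑ p, ∑ q, christoffel g p j k y * (christoffel g q i p y * g y q l)
      - ∑ p, ∑ q, christoffel g p i k y * (christoffel g q j p y * g y q l) := by
    intro k l
    have hsf : ∀ a b c, (fun y' => christoffel g a b c y') = christoffel g a c b := fun a b c => by
      funext y'; exact christoffel_symm hs a b c y'
    rw [Finset.sum_comm (f := fun p q => christoffel g p j k y * (christoffel g q i p y * g y q l)),
      Finset.sum_comm (f := fun p q => christoffel g p i k y * (christoffel g q j p y * g y q l))]
    simp only [riemannLo, riemannUp, ← Finset.sum_add_distrib, ← Finset.sum_sub_distrib]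
    refine Finset.sum_congr rfl fun s _ => ?_
    rw [hsf s k j, hsf s k i, mul_comm (g y s l), sub_mul, add_mul, sub_mul,
      Finset.sum_mul, Finset.sum_mul]
    refine congrArg₂ _ (congrArg₂ _ rfl ?_) ?_ <;> refine Finset.sum_congr rfl fun p _ => ?_
    · rw [christoffel_symm hs p k j, christoffel_symm hs s p i]; ring
    · rw [christoffel_symm hs p k i, christoffel_symm hs s p j]; ring
  have e : ∀ i j k l, ∑ p, ∑ q, christoffel g p j k y * (christoffel g q i l y * g y q p)
      = ∑ p, ∑ q, christoffel g p i l y * (christoffel g q j k y * g y q p) := by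
    intro i j k l
    rw [Finset.sum_comm]
    refine Finset.sum_congr rfl fun p _ => Finset.sum_congr rfl fun q _ => ?_
    rw [hs y p q]
    ring
  rw [hR, hR]
  linear_combination hcomm - e i j k l - e i j l k

end Riemann

section MatrixWirtinger
open Filter Topology Matrix

set_option linter.unusedSectionVars false

variable {m : ℕ} {ι κ μ : Type*} [Fintype ι] [Fintype κ] [Fintype μ]

/-- Entrywise Wirtinger derivative of a matrix-valued function. -/
def wirtM (σ : ℂ) (α : Fin m) (A : EuclideanSpace ℂ (Fin m) → Matrix ι κ ℂ)
    (z : EuclideanSpace ℂ (Fin m)) : Matrix ι κ ℂ :=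
  Matrix.of fun i j => wirt σ α (fun z => A z i j) z

/-- Entrywise continuous differentiability of a matrix-valued function. -/
def MatContDiffAt (k : ℕ) (A : EuclideanSpace ℂ (Fin m) → Matrix ι κ ℂ)
    (z : EuclideanSpace ℂ (Fin m)) : Prop :=
  ∀ i j, ContDiffAt ℝ k (fun z => A z i j) z

variable {σ τ : ℂ} {α β : Fin m} {k : ℕ} {z : EuclideanSpace ℂ (Fin m)}
  {A A' : EuclideanSpace ℂ (Fin m) → Matrix ι κ ℂ} {B : EuclideanSpace ℂ (Fin m) → Matrix κ μ ℂ}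
  {S : EuclideanSpace ℂ (Fin m) → Matrix ι ι ℂ}

lemma MatContDiffAt.of_le (hA : MatContDiffAt k A z) {l : ℕ} (h : l ≤ k) : MatContDiffAt l A z :=
  fun i j => (hA i j).of_le (by exact_mod_cast h)

lemma MatContDiffAt.differentiableAt (hA : MatContDiffAt 1 A z) (i : ι) (j : κ) :
    DifferentiableAt ℝ (fun z => A z i j) z := (hA i j).differentiableAt (by simp)

lemma MatContDiffAt.add (hA : MatContDiffAt k A z) (hA' : MatContDiffAt k A' z) :
    MatContDiffAt k (fun z => A z + A' z) z := fun i j => (hA i j).add (hA' i j)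

lemma MatContDiffAt.sub (hA : MatContDiffAt k A z) (hA' : MatContDiffAt k A' z) :
    MatContDiffAt k (fun z => A z - A' z) z := fun i j => (hA i j).sub (hA' i j)

lemma MatContDiffAt.mul (hA : MatContDiffAt k A z) (hB : MatContDiffAt k B z) :
    MatContDiffAt k (fun z => A z * B z) z := fun i j => by
  simp only [Matrix.mul_apply]
  exact ContDiffAt.sum fun l _ => (hA i l).mul (hB l j)

lemma MatContDiffAt.transpose (hA : MatContDiffAt k A z) :
    MatContDiffAt k (fun z => (A z)ᵀ) z := fun i j => hA j i

lemma MatContDiffAt.inv [DecidableEq ι] (hS : MatContDiffAt k S z) (h : (S z).det ≠ 0) :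
    MatContDiffAt k (fun z => (S z)⁻¹) z := fun i j => ContDiffAt.matrix_inv hS h i j

lemma MatContDiffAt.wirtM (hA : MatContDiffAt (k + 1) A z) :
    MatContDiffAt k (wirtM σ α A) z := fun i j => (hA i j).wirt

lemma wirtM_congr (h : A =ᶠ[𝓝 z] A') : wirtM σ α A z = wirtM σ α A' z := by
  ext i j
  exact wirt_congr (h.mono fun z hz => by simp only [hz])

lemma wirtM_add (hA : MatContDiffAt 1 A z) (hA' : MatContDiffAt 1 A' z) :
    wirtM σ α (fun z => A z + A' z) z = wirtM σ α A z + wirtM σ α A' z := by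
  ext i j
  exact wirt_add (hA.differentiableAt i j) (hA'.differentiableAt i j)

lemma wirtM_sub (hA : MatContDiffAt 1 A z) (hA' : MatContDiffAt 1 A' z) :
    wirtM σ α (fun z => A z - A' z) z = wirtM σ α A z - wirtM σ α A' z := by
  ext i j
  exact wirt_sub (hA.differentiableAt i j) (hA'.differentiableAt i j)

lemma wirtM_neg : wirtM σ α (fun z => - A z) z = - wirtM σ α A z := by
  ext i j
  exact wirt_neg

lemma wirtM_mul (hA : MatContDiffAt 1 A z) (hB : MatContDiffAt 1 B z) :
    wirtM σ α (fun z => A z * B z) z = wirtM σ α A z * B z + A z * wirtM σ α B z := by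
  ext i j
  simp only [wirtM, Matrix.of_apply, Matrix.add_apply, Matrix.mul_apply]
  rw [wirt_sum fun l _ => (hA.differentiableAt i l).fun_mul (hB.differentiableAt l j),
    ← Finset.sum_add_distrib]
  exact Finset.sum_congr rfl fun l _ => wirt_mul (hA.differentiableAt i l) (hB.differentiableAt l j)

lemma wirtM_transpose : wirtM σ α (fun z => (A z)ᵀ) z = (wirtM σ α A z)ᵀ := rfl

lemma wirt_trace (hS : MatContDiffAt 1 S z) :
    wirt σ α (fun z => (S z).trace) z = (wirtM σ α S z).trace :=
  wirt_sum fun i _ => hS.differentiableAt i i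

lemma wirtM_comm (hA : MatContDiffAt 2 A z) :
    wirtM σ α (wirtM τ β A) z = wirtM τ β (wirtM σ α A) z := by
  ext i j
  exact wirt_comm (hA i j)

lemma wirtM_inv [DecidableEq ι] (hS : MatContDiffAt 1 S z) (h : (S z).det ≠ 0) :
    wirtM σ α (fun z => (S z)⁻¹) z = - ((S z)⁻¹ * wirtM σ α S z * (S z)⁻¹) := by
  have hdet : ∀ᶠ z' in 𝓝 z, (S z').det ≠ 0 :=
    (ContDiffAt.matrix_det hS).continuousAt.eventually_ne h
  have e : (fun z => (S z)⁻¹ * S z) =ᶠ[𝓝 z] fun _ => 1 := hdet.mono fun z' h' =>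
    Matrix.nonsing_inv_mul _ (isUnit_iff_ne_zero.2 h')
  have hc : wirtM σ α (fun _ => (1 : Matrix ι ι ℂ)) z = 0 := by
    ext i j
    exact wirt_const _
  have key := wirtM_congr (σ := σ) (α := α) e
  rw [hc, wirtM_mul (hS.inv h) hS] at key
  have k2 := congrArg (· * (S z)⁻¹) key
  simp only [add_mul, Matrix.mul_assoc, Matrix.mul_nonsing_inv _ (isUnit_iff_ne_zero.2 h),
    Matrix.mul_one, Matrix.zero_mul] at k2
  rw [Matrix.mul_assoc]
  exact eq_neg_of_add_eq_zero_left k2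

variable {ν : Type*} [Fintype ν] [DecidableEq ν]
  {P Q : EuclideanSpace ℂ (Fin m) → Matrix ι ν ℂ} {H : EuclideanSpace ℂ (Fin m) → Matrix ν ν ℂ}

lemma wirt_trace_hermitian_pairing (hP : MatContDiffAt 1 P z) (hS : MatContDiffAt 1 S z)
    (hQ : MatContDiffAt 1 Q z) (hH : MatContDiffAt 1 H z) (hdet : (H z).det ≠ 0) :
    wirt σ α (fun z => ((P z)ᵀ * S z * Q z * (H z)⁻¹).trace) z
      = ((wirtM σ α P z)ᵀ * S z * Q z * (H z)⁻¹).trace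
        + ((P z)ᵀ * wirtM σ α S z * Q z * (H z)⁻¹).trace
        + ((P z)ᵀ * S z * wirtM σ α Q z * (H z)⁻¹).trace
        - ((P z)ᵀ * S z * Q z * (H z)⁻¹ * wirtM σ α H z * (H z)⁻¹).trace := by
  have h1 := hP.transpose.mul hS
  rw [wirt_trace ((h1.mul hQ).mul (hH.inv hdet)), wirtM_mul (h1.mul hQ) (hH.inv hdet),
    wirtM_mul h1 hQ, wirtM_mul hP.transpose hS, wirtM_transpose, wirtM_inv hH hdet]
  simp only [← Matrix.trace_add, ← Matrix.trace_sub]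
  congr 1
  simp only [Matrix.add_mul, Matrix.mul_neg, Matrix.mul_assoc]
  abel

/-- Leibniz rule along an antiholomorphic direction, for a metric connection `K`. -/
lemma wirt_trace_pairing_right {K : Matrix ι ι ℂ}
    (hP : MatContDiffAt 1 P z) (hS : MatContDiffAt 1 S z)
    (hQ : MatContDiffAt 1 Q z) (hH : MatContDiffAt 1 H z) (hdet : (H z).det ≠ 0)
    (hK : wirtM σ α S z = Kᵀ * S z + S z * K) :
    wirt σ α (fun z => ((P z)ᵀ * S z * Q z * (H z)⁻¹).trace) z
      = ((wirtM σ α P z + K * P z)ᵀ * S z * Q z * (H z)⁻¹).trace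
        + ((P z)ᵀ * S z * (wirtM σ α Q z + K * Q z - Q z * ((H z)⁻¹ * wirtM σ α H z))
            * (H z)⁻¹).trace := by
  rw [wirt_trace_hermitian_pairing hP hS hQ hH hdet, hK]
  simp only [← Matrix.trace_add, ← Matrix.trace_sub]
  congr 1
  simp only [Matrix.transpose_add, Matrix.transpose_mul, Matrix.add_mul, Matrix.mul_add,
    Matrix.mul_sub, Matrix.sub_mul, Matrix.mul_assoc]
  abel

/-- Leibniz rule along a holomorphic direction, for a metric connection `K`. -/
lemma wirt_trace_pairing_left {K : Matrix ι ι ℂ}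
    (hP : MatContDiffAt 1 P z) (hS : MatContDiffAt 1 S z)
    (hQ : MatContDiffAt 1 Q z) (hH : MatContDiffAt 1 H z) (hdet : (H z).det ≠ 0)
    (hK : wirtM σ α S z = Kᵀ * S z + S z * K) :
    wirt σ α (fun z => ((P z)ᵀ * S z * Q z * (H z)⁻¹).trace) z
      = ((wirtM σ α P z + K * P z - P z * (wirtM σ α H z * (H z)⁻¹)ᵀ)ᵀ
            * S z * Q z * (H z)⁻¹).trace
        + ((P z)ᵀ * S z * (wirtM σ α Q z + K * Q z) * (H z)⁻¹).trace := by
  have hc : ((P z)ᵀ * S z * Q z * (H z)⁻¹ * wirtM σ α H z * (H z)⁻¹).trace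
      = (wirtM σ α H z * (H z)⁻¹ * (P z)ᵀ * S z * Q z * (H z)⁻¹).trace := by
    rw [Matrix.mul_assoc ((P z)ᵀ * S z * Q z * (H z)⁻¹), Matrix.trace_mul_comm]
    simp only [Matrix.mul_assoc]
  rw [wirt_trace_hermitian_pairing hP hS hQ hH hdet, hK, hc]
  simp only [← Matrix.trace_add, ← Matrix.trace_sub]
  congr 1
  simp only [Matrix.transpose_add, Matrix.transpose_sub, Matrix.transpose_mul, Matrix.add_mul,
    Matrix.mul_add, Matrix.sub_mul, Matrix.mul_assoc, Matrix.transpose_transpose]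
  abel

end MatrixWirtinger

section Pullback
open Filter Topology Matrix

variable {m n : ℕ}

/-- Matrix `(∂f^i/∂z^γ)` or `(∂f^i/∂z̄^γ)`, according to the value of `σ`. -/
def jacW (σ : ℂ) (f : EuclideanSpace ℂ (Fin m) → EuclideanSpace ℝ (Fin n))
    (z : EuclideanSpace ℂ (Fin m)) : Matrix (Fin n) (Fin m) ℂ :=
  Matrix.of fun i γ => wirt σ γ (fun z => ((f z i : ℝ) : ℂ)) z

/-- Connection matrix of the pulled back Levi-Civita connection in a Wirtinger direction. -/
def connW (σ : ℂ) (g : EuclideanSpace ℝ (Fin n) → Matrix (Fin n) (Fin n) ℝ)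
    (f : EuclideanSpace ℂ (Fin m) → EuclideanSpace ℝ (Fin n)) (α : Fin m)
    (z : EuclideanSpace ℂ (Fin m)) : Matrix (Fin n) (Fin n) ℂ :=
  Matrix.of fun j b => ∑ k, (christoffel g j k b (f z) : ℂ) * jacW σ f z k α

/-- The pulled back metric coefficients. -/
def metricPull (g : EuclideanSpace ℝ (Fin n) → Matrix (Fin n) (Fin n) ℝ)
    (f : EuclideanSpace ℂ (Fin m) → EuclideanSpace ℝ (Fin n))
    (z : EuclideanSpace ℂ (Fin m)) : Matrix (Fin n) (Fin n) ℂ :=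
  Matrix.of fun i j => (g (f z) i j : ℂ)

variable {g : EuclideanSpace ℝ (Fin n) → Matrix (Fin n) (Fin n) ℝ}
  {f : EuclideanSpace ℂ (Fin m) → EuclideanSpace ℝ (Fin n)} {z : EuclideanSpace ℂ (Fin m)}
  {σ τ : ℂ} {α ν : Fin m} {k : ℕ}

lemma contDiffAt_coe_comp {φ : EuclideanSpace ℝ (Fin n) → ℝ} (hφ : ContDiffAt ℝ k φ (f z))
    (hf : ContDiffAt ℝ k f z) : ContDiffAt ℝ k (fun z => ((φ (f z) : ℝ) : ℂ)) z :=
  Complex.ofRealCLM.contDiff.contDiffAt.comp z (hφ.comp z hf)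

lemma contDiffAt_coe_apply (hf : ContDiffAt ℝ k f z) (i : Fin n) :
    ContDiffAt ℝ k (fun z => ((f z i : ℝ) : ℂ)) z :=
  contDiffAt_coe_comp (φ := fun y => y i) (EuclideanSpace.proj (𝕜 := ℝ) i).contDiff.contDiffAt hf

lemma matContDiffAt_jacW (hf : ContDiffAt ℝ (k + 1 : ℕ) f z) : MatContDiffAt k (jacW σ f) z :=
  fun i _ => (contDiffAt_coe_apply hf i).wirt

lemma matContDiffAt_metricPull (hg : ∀ i j, ContDiffAt ℝ k (fun y => g y i j) (f z))
    (hf : ContDiffAt ℝ k f z) : MatContDiffAt k (metricPull g f) z :=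
  fun i j => contDiffAt_coe_comp (hg i j) hf

lemma matContDiffAt_connW (hg : ∀ i j, ContDiffAt ℝ (k + 1 : ℕ) (fun y => g y i j) (f z))
    (hu : (g (f z)).det ≠ 0) (hf : ContDiffAt ℝ (k + 1 : ℕ) f z) :
    MatContDiffAt k (connW σ g f α) z := fun i j => by
  simp only [connW, Matrix.of_apply]
  refine ContDiffAt.sum fun l _ => ContDiffAt.mul ?_ (matContDiffAt_jacW hf l α)
  exact contDiffAt_coe_comp (ContDiffAt.christoffel hg hu i l j)
    (hf.of_le (by exact_mod_cast k.le_succ))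

lemma wirtM_metricPull (hs : ∀ y i j, g y i j = g y j i)
    (hg : ∀ i j, ContDiffAt ℝ (1 : ℕ) (fun y => g y i j) (f z)) (hu : (g (f z)).det ≠ 0)
    (hf : ContDiffAt ℝ (1 : ℕ) f z) :
    wirtM σ α (metricPull g f) z
      = (connW σ g f α z)ᵀ * metricPull g f z + metricPull g f z * connW σ g f α z := by
  ext i j
  have h := wirt_coe_comp (σ := σ) (α := α) ((hg i j).differentiableAt (by simp))
    (hf.differentiableAt (by simp))
  refine h.trans ?_
  simp only [rDeriv_metric hs ((Matrix.isUnit_iff_isUnit_det _).2 (isUnit_iff_ne_zero.2 hu)),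
    Matrix.add_apply, Matrix.mul_apply, Matrix.transpose_apply, connW, metricPull, Matrix.of_apply,
    Complex.ofReal_sum, Complex.ofReal_add, Complex.ofReal_mul, Finset.sum_mul, Finset.mul_sum]
  rw [Finset.sum_comm, ← Finset.sum_add_distrib]
  refine Finset.sum_congr rfl fun l _ => ?_
  rw [← Finset.sum_add_distrib]
  refine Finset.sum_congr rfl fun k _ => ?_
  simp only [jacW, Matrix.of_apply]
  ring

lemma wirt_connW (hg : ∀ i j, ContDiffAt ℝ (2 : ℕ) (fun y => g y i j) (f z))
    (hu : (g (f z)).det ≠ 0) (hf : ContDiffAt ℝ (2 : ℕ) f z) (j l : Fin n) :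
    wirtM σ α (connW τ g f ν) z j l
      = ∑ b, ∑ i, (rDeriv i (christoffel g j b l) (f z) : ℂ) * jacW σ f z i α * jacW τ f z b ν
        + ∑ b, (christoffel g j b l (f z) : ℂ) *
            wirt σ α (wirt τ ν (fun z => ((f z b : ℝ) : ℂ))) z := by
  have hΓ : ∀ b, ContDiffAt ℝ (1 : ℕ) (christoffel g j b l) (f z) := fun b =>
    ContDiffAt.christoffel hg hu j b l
  have hf1 : ContDiffAt ℝ (1 : ℕ) f z := hf.of_le (by norm_num)
  have h1 : ∀ b, DifferentiableAt ℝ (fun z => (christoffel g j b l (f z) : ℂ)) z := fun b =>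
    (contDiffAt_coe_comp (hΓ b) hf1).differentiableAt (by simp)
  have h2 : ∀ b, DifferentiableAt ℝ (fun z => jacW τ f z b ν) z := fun b =>
    (matContDiffAt_jacW (k := 1) hf).differentiableAt b ν
  have e : wirtM σ α (connW τ g f ν) z j l
      = wirt σ α (fun z => ∑ b, (christoffel g j b l (f z) : ℂ) * jacW τ f z b ν) z := rfl
  rw [e, wirt_sum fun b _ => (h1 b).fun_mul (h2 b), ← Finset.sum_add_distrib]
  refine Finset.sum_congr rfl fun b _ => ?_
  rw [wirt_mul (h1 b) (h2 b), wirt_coe_comp ((hΓ b).differentiableAt (by simp))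
    (hf1.differentiableAt (by simp)), Finset.sum_mul]
  rfl

/-- Curvature of the pulled back Levi-Civita connection. -/
lemma curvature_connW (hs : ∀ y i j, g y i j = g y j i)
    (hg : ∀ i j, ContDiffAt ℝ (2 : ℕ) (fun y => g y i j) (f z))
    (hu : (g (f z)).det ≠ 0) (hf : ContDiffAt ℝ (2 : ℕ) f z) :
    wirtM σ α (connW τ g f ν) z - wirtM τ ν (connW σ g f α) z
        + connW σ g f α z * connW τ g f ν z - connW τ g f ν z * connW σ g f α z
      = Matrix.of fun j l => ∑ i, ∑ b, (riemannUp g i b l j (f z) : ℂ) *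
          jacW σ f z i α * jacW τ f z b ν := by
  have hsf : ∀ a b c, (fun y => christoffel g a b c y) = christoffel g a c b := fun a b c => by
    funext y; exact christoffel_symm hs a b c y
  ext j l
  have hc : ∀ b, wirt τ ν (wirt σ α (fun z => ((f z b : ℝ) : ℂ))) z
      = wirt σ α (wirt τ ν (fun z => ((f z b : ℝ) : ℂ))) z := fun b =>
    wirt_comm (by exact_mod_cast contDiffAt_coe_apply hf b)
  have e1 : ∑ b, ∑ i, (rDeriv i (christoffel g j b l) (f z) : ℂ) * jacW σ f z i α * jacW τ f z b ν
      = ∑ i, ∑ b, (rDeriv i (christoffel g j b l) (f z) : ℂ) * jacW σ f z i α * jacW τ f z b ν :=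
    Finset.sum_comm
  have e2 : (connW σ g f α z * connW τ g f ν z) j l = ∑ i, ∑ b,
      (∑ p, (christoffel g p l b (f z) : ℂ) * christoffel g j p i (f z)) *
        jacW σ f z i α * jacW τ f z b ν := by
    simp only [Matrix.mul_apply, connW, Matrix.of_apply, Finset.sum_mul_sum]
    rw [Finset.sum_comm]
    refine Finset.sum_congr rfl fun i _ => ?_
    rw [Finset.sum_comm]
    refine Finset.sum_congr rfl fun b _ => ?_
    rw [Finset.sum_mul, Finset.sum_mul]
    refine Finset.sum_congr rfl fun p _ => ?_
    rw [christoffel_symm hs p l b, christoffel_symm hs j p i]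
    ring
  have e3 : (connW τ g f ν z * connW σ g f α z) j l = ∑ i, ∑ b,
      (∑ p, (christoffel g p l i (f z) : ℂ) * christoffel g j p b (f z)) *
        jacW σ f z i α * jacW τ f z b ν := by
    simp only [Matrix.mul_apply, connW, Matrix.of_apply, Finset.sum_mul_sum]
    rw [Finset.sum_comm]
    refine Eq.trans ?_ Finset.sum_comm
    refine Finset.sum_congr rfl fun b _ => ?_
    rw [Finset.sum_comm]
    refine Finset.sum_congr rfl fun i _ => ?_
    rw [Finset.sum_mul, Finset.sum_mul]
    refine Finset.sum_congr rfl fun p _ => ?_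
    rw [christoffel_symm hs p l i, christoffel_symm hs j p b]
    ring
  rw [Matrix.sub_apply, Matrix.add_apply, Matrix.sub_apply, wirt_connW hg hu hf,
    wirt_connW hg hu hf, e1, e2, e3]
  simp only [hc, Matrix.of_apply, riemannUp, hsf j l]
  rw [add_sub_add_right_eq_sub]
  simp only [← Finset.sum_add_distrib, ← Finset.sum_sub_distrib]
  refine Finset.sum_congr rfl fun i _ => Finset.sum_congr rfl fun b _ => ?_
  push_cast
  ring

end Pullback

section LocalChernLu
open Filter Topology Matrix

variable {m n : ℕ} {g : EuclideanSpace ℝ (Fin n) → Matrix (Fin n) (Fin n) ℝ}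
  {f : EuclideanSpace ℂ (Fin m) → EuclideanSpace ℝ (Fin n)}
  {H : EuclideanSpace ℂ (Fin m) → Matrix (Fin m) (Fin m) ℂ} {z : EuclideanSpace ℂ (Fin m)}
  {σ τ : ℂ} {α β ν : Fin m}

/-- Covariant derivative of `(∂f^i/∂z̄^γ)` (or its conjugate) for the pulled back connection. -/
def hessW (τ : ℂ) (g : EuclideanSpace ℝ (Fin n) → Matrix (Fin n) (Fin n) ℝ)
    (f : EuclideanSpace ℂ (Fin m) → EuclideanSpace ℝ (Fin n)) (β : Fin m)
    (z : EuclideanSpace ℂ (Fin m)) : Matrix (Fin n) (Fin m) ℂ :=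
  wirtM τ β (jacW τ f) z + connW τ g f β z * jacW τ f z

lemma hessW_symm (hs : ∀ y i j, g y i j = g y j i) (hf : ContDiffAt ℝ (2 : ℕ) f z) (j : Fin n) :
    hessW τ g f β z j ν = hessW τ g f ν z j β := by
  have h : wirt τ β (wirt τ ν (fun z => ((f z j : ℝ) : ℂ))) z
      = wirt τ ν (wirt τ β (fun z => ((f z j : ℝ) : ℂ))) z :=
    wirt_comm (by exact_mod_cast contDiffAt_coe_apply hf j)
  refine congrArg₂ (· + ·) h ?_
  simp only [Matrix.mul_apply, connW, Matrix.of_apply, Finset.sum_mul]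
  rw [Finset.sum_comm]
  refine Finset.sum_congr rfl fun a _ => Finset.sum_congr rfl fun b _ => ?_
  rw [christoffel_symm hs j a b]
  ring

/-- Curvature matrix of the pulled back Levi-Civita connection in Wirtinger directions. -/
def curvW (σ τ : ℂ) (g : EuclideanSpace ℝ (Fin n) → Matrix (Fin n) (Fin n) ℝ)
    (f : EuclideanSpace ℂ (Fin m) → EuclideanSpace ℝ (Fin n)) (α ν : Fin m)
    (z : EuclideanSpace ℂ (Fin m)) : Matrix (Fin n) (Fin n) ℂ :=
  Matrix.of fun j l => ∑ i, ∑ b, (riemannUp g i b l j (f z) : ℂ) *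
    jacW σ f z i α * jacW τ f z b ν

lemma wirtM_hessW (hs : ∀ y i j, g y i j = g y j i)
    (hg : ∀ i j, ContDiffAt ℝ (2 : ℕ) (fun y => g y i j) (f z))
    (hu : (g (f z)).det ≠ 0) (hf : ContDiffAt ℝ (3 : ℕ) f z)
    (hpl : ∀ᶠ z in 𝓝 z, wirtM σ α (jacW τ f) z + connW σ g f α z * jacW τ f z = 0) :
    wirtM σ α (hessW τ g f ν) z + connW σ g f α z * hessW τ g f ν z
      = curvW σ τ g f α ν z * jacW τ f z := by
  have hf2 : ContDiffAt ℝ (2 : ℕ) f z := hf.of_le (by norm_num)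
  have hQ : MatContDiffAt 2 (jacW τ f) z := matContDiffAt_jacW hf
  have hQ1 : MatContDiffAt 1 (jacW τ f) z := hQ.of_le (by norm_num)
  have hK : ∀ σ α, MatContDiffAt 1 (connW σ g f α) z := fun σ α => matContDiffAt_connW hg hu hf2
  have hpl' : wirtM σ α (jacW τ f) =ᶠ[𝓝 z] fun z => - (connW σ g f α z * jacW τ f z) :=
    hpl.mono fun z h => eq_neg_of_add_eq_zero_left h
  have h1 : wirtM σ α (wirtM τ ν (jacW τ f)) z
      = -(wirtM τ ν (connW σ g f α) z * jacW τ f z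
          + connW σ g f α z * wirtM τ ν (jacW τ f) z) := by
    rw [wirtM_comm hQ, wirtM_congr hpl', wirtM_neg, wirtM_mul (hK σ α) hQ1]
  have h2 : wirtM σ α (hessW τ g f ν) z = wirtM σ α (wirtM τ ν (jacW τ f)) z
      + (wirtM σ α (connW τ g f ν) z * jacW τ f z
        + connW τ g f ν z * wirtM σ α (jacW τ f) z) := by
    rw [← wirtM_mul (hK τ ν) hQ1]
    exact wirtM_add hQ.wirtM ((hK τ ν).mul hQ1)
  rw [h2, h1, hpl'.self_of_nhds, curvW, ← curvature_connW hs hg hu hf2, hessW]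
  simp only [Matrix.mul_add, Matrix.add_mul, Matrix.sub_mul, Matrix.mul_neg, Matrix.mul_assoc]
  abel

/-- Chern-Lu formula for a pluri-harmonic map in local coordinates. -/
lemma wirt_wirt_trace_pluriharmonic (hs : ∀ y i j, g y i j = g y j i)
    (hg : ∀ i j, ContDiffAt ℝ (4 : ℕ) (fun y => g y i j) (f z))
    (hu : (g (f z)).det ≠ 0) (hf : ContDiffAt ℝ (4 : ℕ) f z)
    (hH : MatContDiffAt 4 H z) (hdet : (H z).det ≠ 0)
    (hpl : ∀ᶠ z in 𝓝 z, wirtM σ α (jacW τ f) z + connW σ g f α z * jacW τ f z = 0)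
    (hpl' : ∀ᶠ z in 𝓝 z, wirtM τ β (jacW σ f) z + connW τ g f β z * jacW σ f z = 0) :
    wirt σ α (wirt τ β
        fun z => ((jacW σ f z)ᵀ * metricPull g f z * jacW τ f z * (H z)⁻¹).trace) z
      = ((wirtM σ α (jacW σ f) z + connW σ g f α z * jacW σ f z
            - jacW σ f z * (wirtM σ α H z * (H z)⁻¹)ᵀ)ᵀ * metricPull g f z
          * (hessW τ g f β z - jacW τ f z * ((H z)⁻¹ * wirtM τ β H z)) * (H z)⁻¹).trace
        + ((jacW σ f z)ᵀ * metricPull g f z * jacW τ f z * (H z)⁻¹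
          * (wirtM σ α H z * (H z)⁻¹ * wirtM τ β H z - wirtM σ α (wirtM τ β H) z)
          * (H z)⁻¹).trace
        + ((jacW σ f z)ᵀ * metricPull g f z
          * Matrix.of (fun j ν => (curvW σ τ g f α ν z * jacW τ f z) j β) * (H z)⁻¹).trace := by
  have hgood : ∀ᶠ z in 𝓝 z, (∀ i j, ContDiffAt ℝ (4 : ℕ) (fun y => g y i j) (f z)) ∧
      (g (f z)).det ≠ 0 ∧ ContDiffAt ℝ (4 : ℕ) f z ∧ MatContDiffAt 4 H z ∧ (H z).det ≠ 0 := by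
    have hfc := hf.continuousAt
    refine (hfc.eventually (p := fun y => ∀ i j, ContDiffAt ℝ (4 : ℕ) (fun y => g y i j) y) ?_).and
      ((hfc.eventually (p := fun y => (g y).det ≠ 0) ?_).and ((hf.eventually (by simp)).and
        (.and ?_ ?_)))
    · exact eventually_all.2 fun i => eventually_all.2 fun j => (hg i j).eventually (by simp)
    · exact (ContDiffAt.matrix_det hg).continuousAt.eventually_ne hu
    · exact eventually_all.2 fun i => eventually_all.2 fun j => (hH i j).eventually (by simp)
    · exact (ContDiffAt.matrix_det hH).continuousAt.eventually_ne hdet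
  have hfirst : (wirt τ β
        fun z => ((jacW σ f z)ᵀ * metricPull g f z * jacW τ f z * (H z)⁻¹).trace) =ᶠ[𝓝 z]
      fun z => ((jacW σ f z)ᵀ * metricPull g f z *
        (hessW τ g f β z - jacW τ f z * ((H z)⁻¹ * wirtM τ β H z)) * (H z)⁻¹).trace := by
    filter_upwards [hgood, hpl'] with z ⟨hg, hu, hf, hH, hdet⟩ hpl'
    have hg1 : ∀ i j, ContDiffAt ℝ (1 : ℕ) (fun y => g y i j) (f z) := fun i j =>
      (hg i j).of_le (by norm_num)
    have hf1 : ContDiffAt ℝ (1 : ℕ) f z := hf.of_le (by norm_num)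
    have hf2 : ContDiffAt ℝ (1 + 1 : ℕ) f z := hf.of_le (by norm_num)
    rw [wirt_trace_pairing_right (matContDiffAt_jacW hf2) (matContDiffAt_metricPull hg1 hf1)
      (matContDiffAt_jacW hf2) (hH.of_le (by norm_num)) hdet (wirtM_metricPull hs hg1 hu hf1), hpl']
    simp [hessW]
  have hg1 : ∀ i j, ContDiffAt ℝ (1 : ℕ) (fun y => g y i j) (f z) := fun i j =>
    (hg i j).of_le (by norm_num)
  have hg2 : ∀ i j, ContDiffAt ℝ (1 + 1 : ℕ) (fun y => g y i j) (f z) := fun i j =>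
    (hg i j).of_le (by norm_num)
  have hf1 : ContDiffAt ℝ (1 : ℕ) f z := hf.of_le (by norm_num)
  have hf2 : ContDiffAt ℝ (1 + 1 : ℕ) f z := hf.of_le (by norm_num)
  have hf3 : ContDiffAt ℝ (2 + 1 : ℕ) f z := hf.of_le (by norm_num)
  have hP : ∀ σ, MatContDiffAt 2 (jacW σ f) z := fun σ => matContDiffAt_jacW hf3
  have hP1 : ∀ σ, MatContDiffAt 1 (jacW σ f) z := fun σ => matContDiffAt_jacW hf2
  have hH1 : MatContDiffAt 1 H z := hH.of_le (by norm_num)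
  have hH2 : MatContDiffAt 2 H z := hH.of_le (by norm_num)
  have hT : MatContDiffAt 1 (hessW τ g f β) z :=
    (hP τ).wirtM.add ((matContDiffAt_connW hg2 hu hf2).mul (hP1 τ))
  have hB : MatContDiffAt 1 (fun z => (H z)⁻¹ * wirtM τ β H z) z := (hH1.inv hdet).mul hH2.wirtM
  have hsymm : hessW τ g f β =ᶠ[𝓝 z] fun z => Matrix.of fun j ν => hessW τ g f ν z j β := by
    filter_upwards [hgood] with z hz
    ext j ν
    exact hessW_symm hs (hz.2.2.1.of_le (by norm_num)) j
  have hcurv : wirtM σ α (hessW τ g f β) z + connW σ g f α z * hessW τ g f β z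
      = Matrix.of fun j ν => (curvW σ τ g f α ν z * jacW τ f z) j β := by
    rw [wirtM_congr hsymm, hsymm.self_of_nhds]
    ext j ν
    exact congrFun (congrFun (wirtM_hessW (ν := ν) hs hg2 hu hf3 hpl) j) β
  have hBd : wirtM σ α (fun z => (H z)⁻¹ * wirtM τ β H z) z
      = - ((H z)⁻¹ * (wirtM σ α H z * (H z)⁻¹ * wirtM τ β H z
          - wirtM σ α (wirtM τ β H) z)) := by
    rw [wirtM_mul (hH1.inv hdet) hH2.wirtM, wirtM_inv hH1 hdet]
    simp only [Matrix.mul_sub, Matrix.neg_mul, Matrix.mul_assoc]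
    abel
  have hE : wirtM σ α (fun z => hessW τ g f β z - jacW τ f z * ((H z)⁻¹ * wirtM τ β H z)) z
        + connW σ g f α z * (hessW τ g f β z - jacW τ f z * ((H z)⁻¹ * wirtM τ β H z))
      = Matrix.of (fun j ν => (curvW σ τ g f α ν z * jacW τ f z) j β)
        + jacW τ f z * ((H z)⁻¹ * (wirtM σ α H z * (H z)⁻¹ * wirtM τ β H z
          - wirtM σ α (wirtM τ β H) z)) := by
    have h0 := eq_neg_of_add_eq_zero_left hpl.self_of_nhds
    rw [wirtM_sub hT ((hP1 τ).mul hB), wirtM_mul (hP1 τ) hB, hBd, h0, ← hcurv]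
    simp only [Matrix.mul_sub, Matrix.mul_neg, Matrix.neg_mul, Matrix.mul_assoc]
    abel
  rw [wirt_congr hfirst, wirt_trace_pairing_left (hP1 σ) (matContDiffAt_metricPull hg1 hf1)
    (hT.sub ((hP1 τ).mul hB)) hH1 hdet (wirtM_metricPull hs hg1 hu hf1), hE]
  rw [add_assoc, ← Matrix.trace_add ((jacW σ f z)ᵀ * _ * _ * _ * _ * _)]
  congr 2
  simp only [Matrix.mul_add, Matrix.add_mul, Matrix.mul_assoc]
  abel

end LocalChernLu

section Assembly
open Filter Topology Matrix

lemma sum_sum_rotate {A B C : Type*} [Fintype A] [Fintype B] [Fintype C] (F : A → B → C → ℂ) :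
    ∑ a, ∑ b, ∑ c, F a b c = ∑ b, ∑ c, ∑ a, F a b c := by
  rw [Finset.sum_comm]
  exact Finset.sum_congr rfl fun _ _ => Finset.sum_comm

lemma sum_sum_comm_sum_sum {A B C D : Type*} [Fintype A] [Fintype B] [Fintype C] [Fintype D]
    (F : A → B → C → D → ℂ) :
    ∑ a, ∑ b, ∑ c, ∑ d, F a b c d = ∑ c, ∑ d, ∑ a, ∑ b, F a b c d := by
  exact (Finset.sum_congr rfl fun a _ => sum_sum_rotate (F a)).trans
    (sum_sum_rotate fun a c d => ∑ b, F a b c d)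

lemma trace_pairing {ι ν : Type*} [Fintype ι] [Fintype ν] (X Y : Matrix ι ν ℂ) (S : Matrix ι ι ℂ)
    (V : Matrix ν ν ℂ) :
    (Xᵀ * S * Y * V).trace = ∑ γ, ∑ μ, ∑ i, ∑ j, V μ γ * S i j * X i γ * Y j μ := by
  simp only [Matrix.trace, Matrix.diag_apply, Matrix.mul_apply, Matrix.transpose_apply,
    Finset.sum_mul]
  refine Finset.sum_congr rfl fun γ _ => Finset.sum_congr rfl fun μ _ => ?_
  rw [Finset.sum_comm]
  refine Finset.sum_congr rfl fun i _ => Finset.sum_congr rfl fun j _ => ?_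
  ring

variable {g : EuclideanSpace ℝ (Fin n) → Matrix (Fin n) (Fin n) ℝ}
  {f : EuclideanSpace ℂ (Fin m) → EuclideanSpace ℝ (Fin n)} {z : EuclideanSpace ℂ (Fin m)}

lemma metric_mul_curvW (hs : ∀ y i j, g y i j = g y j i)
    (hg : ∀ i j, ContDiffAt ℝ 2 (fun y => g y i j) (f z)) (hu : (g (f z)).det ≠ 0)
    (σ τ : ℂ) (α β ν : Fin m) (k : Fin n) :
    ∑ j, metricPull g f z k j * (curvW σ τ g f α ν z * jacW τ f z) j β
      = - ∑ i, ∑ j, ∑ l, (riemannLo g i l k j (f z) : ℂ) * jacW σ f z i α * jacW τ f z j β *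
          jacW τ f z l ν := by
  have h : ∀ i j l, (riemannLo g i l k j (f z) : ℂ)
      = - ∑ s, metricPull g f z k s * (riemannUp g i l j s (f z) : ℂ) := by
    intro i j l
    rw [riemannLo_antisymm hs hg hu, riemannLo]
    push_cast
    simp only [metricPull, Matrix.of_apply, hs (f z) k]
  simp only [h, curvW, Matrix.mul_apply, Matrix.of_apply, Finset.sum_mul, Finset.mul_sum,
    neg_mul, Finset.sum_neg_distrib, neg_neg]
  rw [Finset.sum_comm]
  have e : ∀ F : Fin n → Fin n → Fin n → Fin n → ℂ,
      ∑ l, ∑ s, ∑ i, ∑ b, F l s i b = ∑ i, ∑ l, ∑ b, ∑ s, F l s i b := fun F =>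
    (Finset.sum_congr rfl fun l _ => sum_sum_rotate _).trans Finset.sum_comm
  rw [e]
  refine Finset.sum_congr rfl fun i _ => Finset.sum_congr rfl fun l _ =>
    Finset.sum_congr rfl fun b _ => Finset.sum_congr rfl fun s _ => ?_
  ring

lemma trace_curvature_term (hs : ∀ y i j, g y i j = g y j i)
    (hg : ∀ i j, ContDiffAt ℝ 2 (fun y => g y i j) (f z)) (hu : (g (f z)).det ≠ 0)
    (σ τ : ℂ) (α β : Fin m) (V : Matrix (Fin m) (Fin m) ℂ) :
    ((jacW σ f z)ᵀ * metricPull g f z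
        * Matrix.of (fun j ν => (curvW σ τ g f α ν z * jacW τ f z) j β) * V).trace
      = - ∑ i, ∑ j, ∑ k, ∑ l, (riemannLo g i l k j (f z) : ℂ) * jacW σ f z i α *
          jacW τ f z j β * (∑ γ, ∑ δ, V δ γ * jacW σ f z k γ * jacW τ f z l δ) := by
  rw [trace_pairing]
  have h1 : ∀ γ μ k, ∑ j, V μ γ * metricPull g f z k j * jacW σ f z k γ
        * (Matrix.of fun j ν => (curvW σ τ g f α ν z * jacW τ f z) j β) j μ
      = - ∑ i, ∑ j, ∑ l, (riemannLo g i l k j (f z) : ℂ) * jacW σ f z i α *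
          jacW τ f z j β * (V μ γ * jacW σ f z k γ * jacW τ f z l μ) := by
    intro γ μ k
    have := congrArg (V μ γ * jacW σ f z k γ * ·) (metric_mul_curvW hs hg hu σ τ α β μ k)
    simp only [mul_neg, Finset.mul_sum] at this
    refine (Finset.sum_congr rfl fun j _ => ?_).trans (this.trans (congrArg _ ?_))
    · simp only [Matrix.of_apply]; ring
    · refine Finset.sum_congr rfl fun i _ => Finset.sum_congr rfl fun j _ =>
        Finset.sum_congr rfl fun l _ => ?_
      ring
  simp only [h1, Finset.sum_neg_distrib, Finset.mul_sum]
  refine congrArg _ ?_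
  have e : ∀ F : Fin m → Fin m → Fin n → Fin n → Fin n → Fin n → ℂ,
      ∑ γ, ∑ μ, ∑ k, ∑ i, ∑ j, ∑ l, F γ μ k i j l
        = ∑ i, ∑ j, ∑ k, ∑ l, ∑ γ, ∑ μ, F γ μ k i j l := by
    intro F
    refine (Finset.sum_congr rfl fun γ _ => Finset.sum_congr rfl fun μ _ =>
      sum_sum_rotate (F := fun k i j => ∑ l, F γ μ k i j l)).trans ?_
    rw [sum_sum_comm_sum_sum]
    exact Finset.sum_congr rfl fun i _ => Finset.sum_congr rfl fun j _ => sum_sum_comm_sum_sum _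
  exact e fun γ μ k i j l => (riemannLo g i l k j (f z) : ℂ) * jacW σ f z i α *
          jacW τ f z j β * (V μ γ * jacW σ f z k γ * jacW τ f z l μ)

lemma trace_chern_term {ι ν : Type*} [Fintype ι] [Fintype ν] (X Y : Matrix ι ν ℂ)
    (S : Matrix ι ι ℂ) (V R : Matrix ν ν ℂ) :
    (Xᵀ * S * Y * V * R * V).trace
      = ∑ γ, ∑ δ, ∑ μ, ∑ κ, ∑ i, ∑ j, R γ δ * V κ γ * V δ μ * S i j * X i μ * Y j κ := by
  have h : (Xᵀ * S * Y * V * R * V) = Xᵀ * S * Y * (V * R * V) := by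
    simp only [Matrix.mul_assoc]
  rw [h, trace_pairing]
  have h2 : ∀ μ κ, (V * R * V) κ μ = ∑ γ, ∑ δ, V κ γ * R γ δ * V δ μ := by
    intro μ κ
    simp only [Matrix.mul_apply, Finset.sum_mul]
    exact Finset.sum_comm
  refine Eq.trans ?_ (sum_sum_comm_sum_sum _).symm
  refine Finset.sum_congr rfl fun μ _ => Finset.sum_congr rfl fun κ _ => ?_
  refine Eq.trans ?_ (sum_sum_comm_sum_sum _).symm
  refine Finset.sum_congr rfl fun i _ => Finset.sum_congr rfl fun j _ => ?_
  rw [h2]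
  simp only [Finset.sum_mul]
  refine Finset.sum_congr rfl fun a _ => Finset.sum_congr rfl fun b _ => ?_
  ring

lemma conj_jacW (i : Fin n) (γ : Fin m) :
    (starRingEnd ℂ) (jacW (-I) f z i γ) = jacW I f z i γ := by
  have h := conj_wirt_coe (σ := -I) (α := γ) (z := z) (f := fun z => f z i)
  simpa [jacW] using h

lemma conj_wirt_jacW (i : Fin n) (γ α : Fin m) :
    (starRingEnd ℂ) (wirt (-I) α (fun z => jacW (-I) f z i γ) z)
      = wirt I α (fun z => jacW I f z i γ) z := by
  rw [conj_wirt]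
  simp [conj_jacW]

lemma HermitianData.det_ne_zero (hD : HermitianData m M) {p : M} {z : EuclideanSpace ℂ (Fin m)}
    (hz : z ∈ (chartAt (EuclideanSpace ℂ (Fin m)) p).target) : (hD.h p z).det ≠ 0 := by
  intro h
  obtain ⟨v, hv, h0⟩ := Matrix.exists_vecMul_eq_zero_iff.2 h
  refine (hD.posdef p z hz v hv).ne' ?_
  rw [Finset.sum_comm]
  refine Finset.sum_eq_zero fun β _ => ?_
  have := congrFun h0 β
  simp only [Matrix.vecMul, dotProduct, Pi.zero_apply] at this
  rw [← Finset.sum_mul, ← zero_mul ((starRingEnd ℂ) (v β)), ← this]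
  simp only [mul_comm]

lemma HermitianData.conj_inv (hD : HermitianData m M) (p : M) (z : EuclideanSpace ℂ (Fin m))
    (α β : Fin m) : (starRingEnd ℂ) ((hD.h p z)⁻¹ α β) = (hD.h p z)⁻¹ β α := by
  have h : (hD.h p z)ᴴ = hD.h p z := by
    ext a b
    exact (hD.hermitian p z a b).symm
  have h2 := Matrix.conjTranspose_nonsing_inv (hD.h p z)
  rw [h] at h2
  exact congrFun (congrFun h2 β) α

lemma delfNormSq_eq_trace (hD : HermitianData m M) (gD : RiemannData n N) (f : M → N) (p : M)
    (z : EuclideanSpace ℂ (Fin m)) : delfNormSq hD gD f p z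
      = ((jacW (-I) (chartRep (m := m) (n := n) f p) z)ᵀ * metricPull (gD.g (f p)) (chartRep (m := m) (n := n) f p) z
          * jacW I (chartRep (m := m) (n := n) f p) z * (hD.h p z)⁻¹).trace := by
  rw [trace_pairing, delfNormSq]
  simp only [← conj_jacW, wDeriv_eq_wirt]
  rfl

lemma delFdelf_eq (hD : HermitianData m M) (gD : RiemannData n N) (f : M → N) (p : M)
    (i : Fin n) (γ α : Fin m) (z : EuclideanSpace ℂ (Fin m)) : delFdelf hD gD f p i γ α z
      = (wirtM (-I) α (jacW (-I) (chartRep (m := m) (n := n) f p)) z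
          + connW (-I) (gD.g (f p)) (chartRep (m := m) (n := n) f p) α z * jacW (-I) (chartRep (m := m) (n := n) f p) z
          - jacW (-I) (chartRep (m := m) (n := n) f p) z
            * (wirtM (-I) α (hD.h p) z * (hD.h p z)⁻¹)ᵀ) i γ := by
  have h1 : ∑ j, ∑ k, (christoffel (gD.g (f p)) i j k (chartRep f p z) : ℂ) *
        wDeriv α (mapComp f p j) z * wDeriv γ (mapComp f p k) z
      = (connW (-I) (gD.g (f p)) (chartRep (m := m) (n := n) f p) α z * jacW (-I) (chartRep (m := m) (n := n) f p) z) i γ := by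
    rw [Finset.sum_comm]
    simp only [Matrix.mul_apply, connW, Matrix.of_apply, Finset.sum_mul, wDeriv_eq_wirt]
    rfl
  have h2 : ∑ μ, hD.chernChristoffel p α γ μ z * wDeriv μ (mapComp f p i) z
      = (jacW (-I) (chartRep (m := m) (n := n) f p) z * (wirtM (-I) α (hD.h p) z * (hD.h p z)⁻¹)ᵀ) i γ := by
    rw [Matrix.mul_apply]
    refine Finset.sum_congr rfl fun μ _ => ?_
    rw [mul_comm, Matrix.transpose_apply, Matrix.mul_apply, HermitianData.chernChristoffel,
      wDeriv_eq_wirt, wDeriv_eq_wirt]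
    refine congrArg₂ _ rfl (Finset.sum_congr rfl fun δ _ => ?_)
    exact mul_comm _ _
  rw [delFdelf, h1, h2, wDeriv_eq_wirt, wDeriv_eq_wirt, Matrix.sub_apply, Matrix.add_apply,
    sub_add_eq_add_sub]
  rfl

lemma conj_delFdelf (hD : HermitianData m M) (gD : RiemannData n N) (f : M → N) (p : M)
    (i : Fin n) (γ α : Fin m) (z : EuclideanSpace ℂ (Fin m)) :
    (starRingEnd ℂ) (delFdelf hD gD f p i γ α z)
      = (hessW I (gD.g (f p)) (chartRep (m := m) (n := n) f p) α z
          - jacW I (chartRep (m := m) (n := n) f p) z * ((hD.h p z)⁻¹ * wirtM I α (hD.h p) z)) i γ := by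
  have hH : ∀ a b, (starRingEnd ℂ) (wirtM (-I) α (hD.h p) z a b) = wirtM I α (hD.h p) z b a := by
    intro a b
    simp only [wirtM, Matrix.of_apply, conj_wirt, ← hD.hermitian]
    simp
  rw [delFdelf_eq, hessW]
  simp only [Matrix.sub_apply, Matrix.add_apply, Matrix.mul_apply, Matrix.transpose_apply,
    map_sub, map_add, map_sum, map_mul, connW, Matrix.of_apply, Complex.conj_ofReal, conj_jacW, hH,
    hD.conj_inv]
  congr 2
  · exact conj_wirt_jacW i γ α
  · funext μ
    exact congrArg _ (Finset.sum_congr rfl fun δ _ => mul_comm _ _)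

lemma chern_eq (hD : HermitianData m M) (p : M) (α β γ δ : Fin m)
    (z : EuclideanSpace ℂ (Fin m)) : hD.chern p α β γ δ z
      = (wirtM (-I) α (hD.h p) z * (hD.h p z)⁻¹ * wirtM I β (hD.h p) z
          - wirtM (-I) α (wirtM I β (hD.h p)) z) γ δ := by
  rw [HermitianData.chern, wDeriv_eq_wirt, wDerivBar_eq_wirt, neg_add_eq_sub, Matrix.sub_apply]
  refine congrArg₂ _ ?_ rfl
  simp only [Matrix.mul_apply, Finset.sum_mul]
  refine Finset.sum_congr rfl fun μ _ => Finset.sum_congr rfl fun ν _ => ?_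
  simp only [HermitianData.up, wirtM, Matrix.of_apply]
  ring

lemma IsPluriHarmonic.jacW_eventually (hD : HermitianData m M) {gD : RiemannData n N} {f : M → N}
    (hf : IsSmoothMap (m := m) (n := n) f) (hpl : IsPluriHarmonic (m := m) gD f) (p : M) :
    ∀ᶠ z in 𝓝 (basePt (m := m) p), ∀ α : Fin m,
      wirtM (-I) α (jacW I (chartRep (m := m) (n := n) f p)) z
          + connW (-I) (gD.g (f p)) (chartRep (m := m) (n := n) f p) α z * jacW I (chartRep (m := m) (n := n) f p) z = 0 ∧
      wirtM I α (jacW (-I) (chartRep (m := m) (n := n) f p)) z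
          + connW I (gD.g (f p)) (chartRep (m := m) (n := n) f p) α z * jacW (-I) (chartRep (m := m) (n := n) f p) z = 0 := by
  filter_upwards [hpl.eventually hD hf p, ((hf.contDiffAt_chartRep p).of_le
    (ENat.LEInfty.out : ((2 : ℕ) : WithTop ℕ∞) ≤ (⊤ : ℕ∞))).eventually (by simp)] with z hz hc α
  have hz' : ∀ i a b, wirt (-I) a (wirt I b (fun z => ((chartRep f p z i : ℝ) : ℂ))) z
      + ∑ j, ∑ k, (christoffel (gD.g (f p)) i j k (chartRep f p z) : ℂ) *
        jacW I (chartRep (m := m) (n := n) f p) z j b * jacW (-I) (chartRep (m := m) (n := n) f p) z k a = 0 := by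
    intro i a b
    have := hz i a b
    rw [pluriTensor, wDeriv_eq_wirt] at this
    simp only [wDerivBar_eq_wirt] at this
    exact this
  constructor <;> ext i γ <;> rw [Matrix.add_apply, Matrix.zero_apply]
  · refine Eq.trans (congrArg₂ (· + ·) rfl ?_) (hz' i α γ)
    simp only [Matrix.mul_apply, connW, Matrix.of_apply, Finset.sum_mul]
    refine Finset.sum_congr rfl fun j _ => Finset.sum_congr rfl fun k _ => ?_
    rw [christoffel_symm (gD.symm (f p)) i k j]
    ring
  · refine Eq.trans (congrArg₂ (· + ·) ?_ ?_) (hz' i γ α)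
    · exact wirt_comm (by exact_mod_cast contDiffAt_coe_apply hc i)
    simp only [Matrix.mul_apply, connW, Matrix.of_apply, Finset.sum_mul]
    exact Finset.sum_comm

end Assembly

/-- Proposition 1.8 / Proposition 3.2, Chern-Lu type identity.
For a pluri-harmonic map `f : (M,h) → (N,g)` and `u = |∂f|²`, the `(1,1)`-form
`∂∂̄u` has components
`∂_α ∂̄_β u = ⟨∂_F ∂f, ∂_F ∂f⟩_{α β̄}
  + R^M_{α β̄ γ δ̄} h^{γ ν̄} h^{μ δ̄} g_{ij} f^i_μ f^j_ν̄
  − R^N_{iℓkj} f^i_α f^j_β̄ (h^{γ δ̄} f^k_γ f^ℓ_δ̄)`. -/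
theorem chernLu_hessian_of_pluriharmonic
    (hD : HermitianData m M) (gD : RiemannData n N)
    (f : M → N) (hf : IsSmoothMap (m := m) (n := n) f) (hpluri : IsPluriHarmonic (m := m) gD f) :
    ∀ (p : M) (α β : Fin m),
      wDeriv α (fun z => wDerivBar β (delfNormSq hD gD f p) z) (basePt p)
      = (∑ γ, ∑ ν, ∑ i, ∑ j, hD.up p (basePt p) γ ν *
          (gD.g (f p) (chartRep f p (basePt (m := m) p)) i j : ℂ) *
          delFdelf hD gD f p i γ α (basePt p) *
          (starRingEnd ℂ) (delFdelf hD gD f p j ν β (basePt p)))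
        + (∑ γ, ∑ δ, ∑ μ, ∑ ν, ∑ i, ∑ j,
            hD.chern p α β γ δ (basePt p) * hD.up p (basePt p) γ ν *
            hD.up p (basePt p) μ δ *
            (gD.g (f p) (chartRep f p (basePt (m := m) p)) i j : ℂ) *
            wDeriv μ (mapComp f p i) (basePt p) *
            wDerivBar ν (mapComp f p j) (basePt p))
        - (∑ i, ∑ j, ∑ k, ∑ l,
            (riemannLo (gD.g (f p)) i l k j (chartRep f p (basePt (m := m) p)) : ℂ) *
            wDeriv α (mapComp f p i) (basePt p) *
            wDerivBar β (mapComp f p j) (basePt p) *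
            (∑ γ, ∑ δ, hD.up p (basePt p) γ δ *
              wDeriv γ (mapComp f p k) (basePt p) *
              wDerivBar δ (mapComp f p l) (basePt p))) := by
  intro p α β
  have hz : basePt p ∈ (chartAt (EuclideanSpace ℂ (Fin m)) p).target := mem_chart_target _ p
  have hrep : chartRep (m := m) (n := n) f p (basePt p)
      = chartAt (EuclideanSpace ℝ (Fin n)) (f p) (f p) := by
    simp [chartRep, basePt]
  have hy : chartRep (m := m) (n := n) f p (basePt p)
      ∈ (chartAt (EuclideanSpace ℝ (Fin n)) (f p)).target := by
    rw [hrep]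
    exact mem_chart_target _ _
  have hle : ∀ k : ℕ, (k : WithTop ℕ∞) ≤ (⊤ : ℕ∞) := fun k => by exact_mod_cast le_top
  have hu : (gD.g (f p) (chartRep (m := m) (n := n) f p (basePt p))).det ≠ 0 :=
    (gD.posDef hy).det_pos.ne'
  have hg := fun i j => gD.contDiffAt hy i j
  have hf' := hf.contDiffAt_chartRep (m := m) (n := n) p
  have hpl := hpluri.jacW_eventually hD hf p
  have hnorm : delfNormSq hD gD f p = _ := funext fun z => delfNormSq_eq_trace hD gD f p z
  have key := wirt_wirt_trace_pluriharmonic (H := hD.h p) (σ := -I) (τ := I) (α := α) (β := β)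
    (gD.symm (f p)) (fun i j => (hg i j).of_le (hle 4)) hu (hf'.of_le (hle 4))
    (fun a b => (hD.contDiffAt hz a b).of_le (hle 4)) (hD.det_ne_zero hz)
    (hpl.mono fun z h => (h α).1) (hpl.mono fun z h => (h β).2)
  rw [← hnorm, trace_pairing, trace_chern_term, trace_curvature_term (gD.symm (f p))
    (fun i j => (hg i j).of_le (hle 2)) hu] at key
  simp only [← delFdelf_eq, ← conj_delFdelf, ← chern_eq] at key
  have e₁ : ∀ i γ, jacW (-I) (chartRep (m := m) (n := n) f p) (basePt p) i γ
      = wDeriv γ (mapComp f p i) (basePt p) := fun i γ => by rw [wDeriv_eq_wirt]; rfl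
  have e₂ : ∀ i γ, jacW I (chartRep (m := m) (n := n) f p) (basePt p) i γ
      = wDerivBar γ (mapComp f p i) (basePt p) := fun i γ => by rw [wDerivBar_eq_wirt]; rfl
  have e₃ : ∀ γ ν, (hD.h p (basePt p))⁻¹ ν γ = hD.up p (basePt p) γ ν := fun _ _ => rfl
  have e₄ : ∀ i j, metricPull (gD.g (f p)) (chartRep (m := m) (n := n) f p) (basePt p) i j
      = ((gD.g (f p) (chartRep (m := m) (n := n) f p (basePt p)) i j : ℝ) : ℂ) := fun _ _ => rfl
  simp only [e₁, e₂, e₃, e₄, ← sub_eq_add_neg] at key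
  rw [← wDeriv_eq_wirt, ← wDerivBar_eq_wirt] at key
  exact key
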